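/- arXiv:2307.00962 — 3 statements merged into one kernel-verified Lean document; each statement's English description precedes it below -/
import Mathlib

section
/- Assume (A-1) and fix θ ∈ ℂ with Im θ < 0. Then the circle {z ∈ ℂ : |z| = e^{Im θ}} is contained in the spectrum of U(θ), and for every z ∈ ℂ with |z| ≠ e^{Im θ}, if U(θ) − z·Id is not boundedly invertible then z is an eigenvalue of U(θ) with finite-dimensional eigenspace (i.e. the essential spectrum of U(θ) is exactly the circle of radius e^{Im θ}). -/
noncomputable section

namespace QWPaper

open Complex

/-- Sites of the two-dimensional lattice. -/
abbrev Site : Type := ℤ × ℤ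

/-- Chirality indices: `0 = ←`, `1 = →`, `2 = ↓`, `3 = ↑`. -/
abbrev Chir : Type := Fin 4

abbrev V : Type := EuclideanSpace ℂ (Fin 4)

/-- The Hilbert space `H = ℓ²(ℤ²; ℂ⁴)`. -/
abbrev H : Type := lp (fun _ : Site => V) 2

/-- The inner domain `Ω^i = {x : |x₁| ≤ M₀, |x₂| ≤ M₀}`. -/
def innerDom (M₀ : ℤ) : Set Site := {x | |x.1| ≤ M₀ ∧ |x.2| ≤ M₀}

/-- `S` is the shift operator:
`(Su)(x) = (u_←(x+e₁), u_→(x−e₁), u_↓(x+e₂), u_↑(x−e₂))`. -/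
def IsShiftOp (S : H →L[ℂ] H) : Prop :=
  ∀ (u : H) (x : Site),
    (S u) x 0 = u (x.1 + 1, x.2) 0 ∧
    (S u) x 1 = u (x.1 - 1, x.2) 1 ∧
    (S u) x 2 = u (x.1, x.2 + 1) 2 ∧
    (S u) x 3 = u (x.1, x.2 - 1) 3

/-- `A` is the bounded operator of pointwise multiplication by the matrix family `C`. -/
def IsCoinOp (A : H →L[ℂ] H) (C : Site → Matrix Chir Chir ℂ) : Prop :=
  ∀ (u : H) (x : Site) (i : Chir), (A u) x i = ∑ j : Chir, C x i j * u x j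

/-- Every coin matrix is unitary. -/
def IsUnitaryCoin (C : Site → Matrix Chir Chir ℂ) : Prop :=
  ∀ x, C x ∈ Matrix.unitaryGroup Chir ℂ

/-- Assumption (A-1): `C(x) = I₄` off `Ω^i`, with `M₀ ≥ 1`. -/
def SatisfiesA1 (C : Site → Matrix Chir Chir ℂ) (M₀ : ℤ) : Prop :=
  1 ≤ M₀ ∧ ∀ x, x ∉ innerDom M₀ → C x = 1

/-- `D_x(θ) = diag(e^{iθx₁}, e^{−iθx₁}, e^{iθx₂}, e^{−iθx₂})`. -/
def Dmat (θ : ℂ) (x : Site) : Matrix Chir Chir ℂ :=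
  Matrix.diagonal ![Complex.exp (Complex.I * θ * x.1), Complex.exp (-(Complex.I * θ * x.1)),
    Complex.exp (Complex.I * θ * x.2), Complex.exp (-(Complex.I * θ * x.2))]

/-- The translated coin `D_x(θ) C(x) D_x(θ)⁻¹`. -/
def transCoin (θ : ℂ) (C : Site → Matrix Chir Chir ℂ) (x : Site) : Matrix Chir Chir ℂ :=
  Dmat θ x * C x * (Dmat θ x)⁻¹

/-- The complex translated walk `U(θ) = e^{−iθ} S M(θ)`. -/
def transWalkOp (θ : ℂ) (S Mθ : H →L[ℂ] H) : H →L[ℂ] H :=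
  Complex.exp (-(Complex.I * θ)) • (S.comp Mθ)

/-- `⟨x⟩ = (1 + |x|²)^{1/2}`. -/
def jnorm (x : Site) : ℝ := Real.sqrt (1 + ((x.1 : ℝ) ^ 2 + (x.2 : ℝ) ^ 2))

/-- Super-exponentially decreasing elements of `H`: `e^{τ⟨x⟩} f ∈ H` for every `τ > 0`. -/
def SuperExpDecay (f : H) : Prop :=
  ∀ τ : ℝ, 0 < τ → Memℓp (fun x : Site => (Real.exp (τ * jnorm x) • f x : V)) 2

/-- Pointwise shift of an arbitrary `ℂ⁴`-valued map on `ℤ²`. -/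
def ptShift (v : Site → Chir → ℂ) (x : Site) : Chir → ℂ :=
  ![v (x.1 + 1, x.2) 0, v (x.1 - 1, x.2) 1, v (x.1, x.2 + 1) 2, v (x.1, x.2 - 1) 3]

/-- Pointwise coin action on an arbitrary `ℂ⁴`-valued map on `ℤ²`. -/
def ptCoin (C : Site → Matrix Chir Chir ℂ) (u : Site → Chir → ℂ) (x : Site) (i : Chir) : ℂ :=
  ∑ j : Chir, C x i j * u x j

/-- Pointwise action of the walk `U = SC` on arbitrary `ℂ⁴`-valued maps. -/
def ptWalk (C : Site → Matrix Chir Chir ℂ) (u : Site → Chir → ℂ) : Site → Chir → ℂ :=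
  ptShift (ptCoin C u)

/-- `u` is a pointwise solution of `U u = e^{−iκ} u`. -/
def IsPtSolution (C : Site → Matrix Chir Chir ℂ) (κ : ℂ) (u : Site → Chir → ℂ) : Prop :=
  ∀ (x : Site) (i : Chir), ptWalk C u x i = Complex.exp (-(Complex.I * κ)) * u x i

/-- `u` is outgoing with the explicit sequences `aL aR aD aU`. -/
def IsOutgoingWith (M₀ : ℤ) (κ : ℂ) (aL aR aD aU : ℤ → ℂ) (u : Site → Chir → ℂ) : Prop :=
  (∀ x : Site, x.1 < -M₀ → u x 0 = aL x.2 * Complex.exp (-(Complex.I * κ * x.1))) ∧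
  (∀ x : Site, M₀ < x.1 → u x 0 = 0) ∧
  (∀ x : Site, x.1 < -M₀ → u x 1 = 0) ∧
  (∀ x : Site, M₀ < x.1 → u x 1 = aR x.2 * Complex.exp (Complex.I * κ * x.1)) ∧
  (∀ x : Site, x.2 < -M₀ → u x 2 = aD x.1 * Complex.exp (-(Complex.I * κ * x.2))) ∧
  (∀ x : Site, M₀ < x.2 → u x 2 = 0) ∧
  (∀ x : Site, x.2 < -M₀ → u x 3 = 0) ∧
  (∀ x : Site, M₀ < x.2 → u x 3 = aU x.1 * Complex.exp (Complex.I * κ * x.2))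

/-- `u` is an outgoing map. -/
def IsOutgoing (M₀ : ℤ) (κ : ℂ) (u : Site → Chir → ℂ) : Prop :=
  ∃ aL aR aD aU : ℤ → ℂ, IsOutgoingWith M₀ κ aL aR aD aU u

/-- Elastic coin: column `j` of `C_el(x)` is `e^{iα_j(x)} 𝐞_{σ(x)(j)}`. -/
def elasticCoin (σ : Site → Equiv.Perm Chir) (α : Site → Chir → ℝ) (x : Site) :
    Matrix Chir Chir ℂ :=
  Matrix.of fun i j => if i = σ x j then Complex.exp (Complex.I * (α x j : ℂ)) else 0

/-- The initial state `δ_y 𝐞_j ∈ H`. -/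
def deltaState (y : Site) (j : Chir) : H := lp.single 2 y (EuclideanSpace.single j 1)

/-- `(q, p)` is the trajectory map of the elastic walk `Uel`:
`Uel^t (δ_y 𝐞_j)` is a modulus-one multiple of `δ_{q(t,y,j)} 𝐞_{p(t,y,j)}`. -/
def IsTrajectory (Uel : unitary (H →L[ℂ] H))
    (q : ℤ → Site → Chir → Site) (p : ℤ → Site → Chir → Chir) : Prop :=
  (∀ y j, q 0 y j = y ∧ p 0 y j = j) ∧
  ∀ (t : ℤ) (y : Site) (j : Chir), ∃ c : ℂ, ‖c‖ = 1 ∧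
    ((Uel ^ t : unitary (H →L[ℂ] H)) : H →L[ℂ] H) (deltaState y j)
      = c • deltaState (q t y j) (p t y j)

/-- Euclidean norm of a lattice point. -/
def znorm (x : Site) : ℝ := Real.sqrt ((x.1 : ℝ) ^ 2 + (x.2 : ℝ) ^ 2)

/-- The parts of the barrier `K`. -/
def K1p (M₀ : ℤ) : Set Site := {x | x.1 = M₀ ∧ |x.2| ≤ M₀}
def K1m (M₀ : ℤ) : Set Site := {x | x.1 = -M₀ ∧ |x.2| ≤ M₀}
def K2p (M₀ : ℤ) : Set Site := {x | x.2 = M₀ ∧ |x.1| ≤ M₀}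
def K2m (M₀ : ℤ) : Set Site := {x | x.2 = -M₀ ∧ |x.1| ≤ M₀}
def Kbar (M₀ : ℤ) : Set Site := K1p M₀ ∪ K1m M₀ ∪ K2p M₀ ∪ K2m M₀

/-- The exterior domain `Ω^e = (ℤ² \ Ω^i) ∪ K`. -/
def outerDom (M₀ : ℤ) : Set Site := {x | x ∉ innerDom M₀} ∪ Kbar M₀

/-- Membership in the interior space `H_i`. -/
def memHi (M₀ : ℤ) (u : H) : Prop :=
  (∀ x, x ∉ innerDom M₀ → ∀ i : Chir, u x i = 0) ∧
  (∀ x ∈ K1p M₀, u x 0 = 0) ∧ (∀ x ∈ K1m M₀, u x 1 = 0) ∧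
  (∀ x ∈ K2p M₀, u x 2 = 0) ∧ (∀ x ∈ K2m M₀, u x 3 = 0)

/-- Membership in the exterior space `H_e`. -/
def memHe (M₀ : ℤ) (u : H) : Prop :=
  (∀ x, x ∉ outerDom M₀ → ∀ i : Chir, u x i = 0) ∧
  (∀ x ∈ K1m M₀ ∪ K2p M₀ ∪ K2m M₀, u x 0 = 0) ∧
  (∀ x ∈ K1p M₀ ∪ K2p M₀ ∪ K2m M₀, u x 1 = 0) ∧
  (∀ x ∈ K2m M₀ ∪ K1p M₀ ∪ K1m M₀, u x 2 = 0) ∧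
  (∀ x ∈ K2p M₀ ∪ K1p M₀ ∪ K1m M₀, u x 3 = 0)

/-- The non-penetrable barrier conditions for `U_np`. -/
def IsBarrierWalk (M₀ : ℤ) (Unp : H →L[ℂ] H) : Prop :=
  ∀ u : H,
    (∀ x ∈ K1p M₀, (Unp u) (x.1 + 1, x.2) 1 = u x 0) ∧
    (∀ x ∈ K1m M₀, (Unp u) (x.1 - 1, x.2) 0 = u x 0) ∧
    (∀ x ∈ K2p M₀, (Unp u) (x.1, x.2 + 1) 3 = u x 2) ∧
    (∀ x ∈ K2m M₀, (Unp u) (x.1, x.2 - 1) 2 = u x 3)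

/-- The rectangular loop `L_{ε,s}(μ)` (boundary of the rectangle with half-widths `a`, `b`). -/
def loopSet (μ a b : ℝ) : Set ℂ :=
  {κ | |κ.re - μ| ≤ a ∧ |κ.im| ≤ b ∧ (|κ.re - μ| = a ∨ |κ.im| = b)}

/-- The four-corner elastic coin. -/
def fourCornerCoin (m₀ n₀ : ℤ) (x : Site) : Matrix Chir Chir ℂ :=
  if x = ((0 : ℤ), (0 : ℤ)) then !![0,1,0,0; 0,0,1,0; 0,0,0,1; 1,0,0,0]
  else if x = (m₀, (0 : ℤ)) then !![0,0,1,0; 1,0,0,0; 0,0,0,1; 0,1,0,0]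
  else if x = (m₀, n₀) then !![0,0,0,1; 1,0,0,0; 0,1,0,0; 0,0,1,0]
  else if x = ((0 : ℤ), n₀) then !![0,1,0,0; 0,0,0,1; 1,0,0,0; 0,0,1,0]
  else 1

/-- The four corners. -/
def corners (m₀ n₀ : ℤ) : Set Site :=
  {((0 : ℤ), (0 : ℤ)), (m₀, (0 : ℤ)), (m₀, n₀), ((0 : ℤ), n₀)}

/-- A perturbed four-corner coin `C_ε`. -/
def IsPerturbedFourCorner (m₀ n₀ : ℤ) (ε : ℝ) (Cε : Site → Matrix Chir Chir ℂ) : Prop :=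
  IsUnitaryCoin Cε ∧
  (∀ x, x ∉ corners m₀ n₀ → Cε x = 1) ∧
  (∀ x ∈ corners m₀ n₀, ∀ i j : Chir, ‖Cε x i j - fourCornerCoin m₀ n₀ x i j‖ < ε) ∧
  Cε ((0 : ℤ), (0 : ℤ)) 1 0 = 0 ∧ Cε ((0 : ℤ), (0 : ℤ)) 3 2 = 0 ∧
  Cε (m₀, (0 : ℤ)) 3 2 = 0 ∧ Cε (m₀, (0 : ℤ)) 0 1 = 0 ∧
  Cε (m₀, n₀) 2 3 = 0 ∧ Cε (m₀, n₀) 0 1 = 0 ∧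
  Cε ((0 : ℤ), n₀) 1 0 = 0 ∧ Cε ((0 : ℤ), n₀) 2 3 = 0

/-- `c_ε⁺ = c_{↑,←}(0,0) c_{←,↓}(m₀,0) c_{↓,→}(m₀,n₀) c_{→,↑}(0,n₀)`. -/
def cPlus (m₀ n₀ : ℤ) (Cε : Site → Matrix Chir Chir ℂ) : ℂ :=
  Cε ((0 : ℤ), (0 : ℤ)) 3 0 * Cε (m₀, (0 : ℤ)) 0 2 * Cε (m₀, n₀) 2 1 * Cε ((0 : ℤ), n₀) 1 3

/-- `c_ε⁻ = c_{→,↓}(0,0) c_{↑,→}(m₀,0) c_{←,↑}(m₀,n₀) c_{↓,←}(0,n₀)`. -/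
def cMinus (m₀ n₀ : ℤ) (Cε : Site → Matrix Chir Chir ℂ) : ℂ :=
  Cε ((0 : ℤ), (0 : ℤ)) 1 2 * Cε (m₀, (0 : ℤ)) 3 1 * Cε (m₀, n₀) 0 3 * Cε ((0 : ℤ), n₀) 2 0

/-- `u ∈ H` is supported on the set `A ⊆ ℤ² × {←,→,↓,↑}`. -/
def SupportedOn (u : H) (A : Set (Site × Chir)) : Prop :=
  ∀ (x : Site) (i : Chir), (x, i) ∉ A → u x i = 0

/-- The image of the closed trajectory `Φ₊` of the four-corner walk. -/
def imPhiPlus (m₀ n₀ : ℤ) : Set (Site × Chir) :=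
  {w | ∃ t : ℤ, 1 ≤ t ∧ t ≤ n₀ ∧ w = (((0 : ℤ), t), (3 : Chir))} ∪
  {w | ∃ t : ℤ, 1 ≤ t ∧ t ≤ m₀ ∧ w = ((t, n₀), (1 : Chir))} ∪
  {w | ∃ t : ℤ, 0 ≤ t ∧ t ≤ n₀ - 1 ∧ w = ((m₀, t), (2 : Chir))} ∪
  {w | ∃ t : ℤ, 0 ≤ t ∧ t ≤ m₀ - 1 ∧ w = ((t, (0 : ℤ)), (0 : Chir))}

/-- The image of the reversed closed trajectory `Φ₋` of the four-corner walk. -/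
def imPhiMinus (m₀ n₀ : ℤ) : Set (Site × Chir) :=
  {w | ∃ t : ℤ, 1 ≤ t ∧ t ≤ m₀ ∧ w = ((t, (0 : ℤ)), (1 : Chir))} ∪
  {w | ∃ t : ℤ, 1 ≤ t ∧ t ≤ n₀ ∧ w = ((m₀, t), (3 : Chir))} ∪
  {w | ∃ t : ℤ, 0 ≤ t ∧ t ≤ m₀ - 1 ∧ w = ((t, n₀), (0 : Chir))} ∪
  {w | ∃ t : ℤ, 0 ≤ t ∧ t ≤ n₀ - 1 ∧ w = (((0 : ℤ), t), (2 : Chir))}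

/-- The eight outgoing tails starting from the four corners. -/
def tails (m₀ n₀ : ℤ) : Set (Site × Chir) :=
  {w | ∃ N y₂ : ℤ, 1 ≤ N ∧ (y₂ = 0 ∨ y₂ = n₀) ∧ w = ((-N, y₂), (0 : Chir))} ∪
  {w | ∃ N y₁ : ℤ, 1 ≤ N ∧ (y₁ = 0 ∨ y₁ = m₀) ∧ w = ((y₁, n₀ + N), (3 : Chir))} ∪
  {w | ∃ N y₁ : ℤ, 1 ≤ N ∧ (y₁ = 0 ∨ y₁ = m₀) ∧ w = ((y₁, -N), (2 : Chir))} ∪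
  {w | ∃ N y₂ : ℤ, 1 ≤ N ∧ (y₂ = 0 ∨ y₂ = n₀) ∧ w = ((m₀ + N, y₂), (1 : Chir))}

/-- The shape resonance perturbation `C_ε` of the barrier coin `C_np`. -/
def IsShapePerturbation (M₀ : ℤ) (Cnp : Site → Matrix Chir Chir ℂ) (ε : ℝ)
    (Cε : Site → Matrix Chir Chir ℂ) : Prop :=
  IsUnitaryCoin Cε ∧ (∀ x, x ∉ Kbar M₀ → Cε x = Cnp x) ∧
  (∀ x ∈ Kbar M₀, ∀ i j : Chir, ‖Cε x i j - Cnp x i j‖ < ε)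

/-- Counterclockwise contour integral of an operator-valued map over the boundary of the
rectangle centered at `μ ∈ ℝ` with half-widths `a` and `b`. -/
def rectIntegral (f : ℂ → (H →L[ℂ] H)) (μ a b : ℝ) : H →L[ℂ] H :=
  ((∫ t in (μ - a)..(μ + a), f (t - b * Complex.I)) -
      (∫ t in (μ - a)..(μ + a), f (t + b * Complex.I))) +
  Complex.I • ((∫ s in (-b)..b, f ((μ + a : ℝ) + s * Complex.I)) -
      (∫ s in (-b)..b, f ((μ - a : ℝ) + s * Complex.I)))

/-- The Riesz-type projection `(1/2π) ∮ e^{−iκ} (A − e^{−iκ})^{−1} dκ` over the rectangular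
loop of half-widths `a`, `b` around `μ`. -/
def rieszProj (A : H →L[ℂ] H) (μ a b : ℝ) : H →L[ℂ] H :=
  (1 / (2 * Real.pi)) •
    rectIntegral (fun κ => Complex.exp (-(Complex.I * κ)) •
      Ring.inverse (A - Complex.exp (-(Complex.I * κ)) • (1 : H →L[ℂ] H))) μ a b

/-! ### Auxiliary lemmas for the main theorem -/

/-- Square-summability of an element of `H`, componentwise. -/
theorem aux_hasSum_comp (u : H) (i : Chir) : Summable (fun x : Site => ‖u x i‖ ^ 2) := by
  have h := (lp.hasSum_norm (p := 2) (by norm_num) u).summable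
  refine Summable.of_nonneg_of_le (fun _ => by positivity) (fun x => ?_) h
  have h1 : ‖u x i‖ ≤ ‖u x‖ := PiLp.norm_apply_le (u x) i
  have : ‖u x‖ ^ (ENNReal.toReal 2) = ‖u x‖ ^ 2 := by
    norm_num
  rw [this]
  gcongr

theorem aux_norm_sq (u : H) : ‖u‖ ^ 2 = ∑ i : Chir, ∑' x : Site, ‖u x i‖ ^ 2 := by
  have h := lp.norm_rpow_eq_tsum (p := 2) (by norm_num) u
  have e : (ENNReal.toReal 2) = ((2 : ℕ) : ℝ) := by norm_num
  simp only [e, Real.rpow_natCast] at h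
  rw [h, ← Summable.tsum_finsetSum (fun i _ => aux_hasSum_comp u i)]
  refine tsum_congr fun x => ?_
  rw [EuclideanSpace.norm_sq_eq]

theorem aux_memlp (f : Site → V) (h : ∀ i : Chir, Summable (fun x : Site => ‖f x i‖ ^ 2)) :
    Memℓp f 2 := by
  refine memℓp_gen ?_
  have e : (ENNReal.toReal 2) = ((2 : ℕ) : ℝ) := by norm_num
  simp only [e, Real.rpow_natCast, EuclideanSpace.norm_sq_eq]
  exact summable_sum fun i _ => h i

/-- The site permutation underlying each component of the shift. -/
def auxPerm (i : Chir) : Site ≃ Site :=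
  Equiv.addRight ((![(1, 0), (-1, 0), (0, 1), (0, -1)] : Fin 4 → Site) i)

theorem aux_shift_apply {S : H →L[ℂ] H} (hS : IsShiftOp S) (u : H) (x : Site) (i : Chir) :
    (S u) x i = u (auxPerm i x) i := by
  obtain ⟨h0, h1, h2, h3⟩ := hS u x
  obtain ⟨a, b⟩ := x
  fin_cases i
  · simpa [auxPerm] using h0
  · simpa [auxPerm, sub_eq_add_neg] using h1
  · simpa [auxPerm] using h2
  · simpa [auxPerm, sub_eq_add_neg] using h3

theorem aux_shift_norm {S : H →L[ℂ] H} (hS : IsShiftOp S) (u : H) : ‖S u‖ = ‖u‖ := by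
  have : ‖S u‖ ^ 2 = ‖u‖ ^ 2 := by
    rw [aux_norm_sq, aux_norm_sq]
    refine Finset.sum_congr rfl fun i _ => ?_
    simp only [aux_shift_apply hS]
    exact (auxPerm i).tsum_eq (fun x => ‖u x i‖ ^ 2)
  exact (sq_eq_sq₀ (norm_nonneg _) (norm_nonneg _)).1 this

theorem aux_shift_surj {S : H →L[ℂ] H} (hS : IsShiftOp S) : Function.Surjective S := by
  intro v
  let f : Site → V := fun x => WithLp.toLp 2 (fun i => v ((auxPerm i).symm x) i)
  have hf : Memℓp f 2 := by
    refine aux_memlp f fun i => ?_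
    exact ((auxPerm i).symm.summable_iff (f := fun x => ‖v x i‖ ^ 2)).2 (aux_hasSum_comp v i)
  refine ⟨⟨f, hf⟩, ?_⟩
  ext x i
  rw [aux_shift_apply hS]
  change v ((auxPerm i).symm (auxPerm i x)) i = v x i
  rw [Equiv.symm_apply_apply]

theorem aux_shift_unitary {S : H →L[ℂ] H} (hS : IsShiftOp S) : S ∈ unitary (H →L[ℂ] H) := by
  let L : H →ₗᵢ[ℂ] H := ⟨S.toLinearMap, aux_shift_norm hS⟩
  let e : H ≃ₗᵢ[ℂ] H := LinearIsometryEquiv.ofSurjective L (aux_shift_surj hS)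
  have : S = ((Unitary.linearIsometryEquiv.symm e : unitary (H →L[ℂ] H)) : H →L[ℂ] H) := by
    rw [Unitary.coe_symm_linearIsometryEquiv_apply]
    ext1 u
    rfl
  rw [this]
  exact (Unitary.linearIsometryEquiv.symm e).2

theorem aux_transCoin {M₀ : ℤ} {C : Site → Matrix Chir Chir ℂ} (hA1 : SatisfiesA1 C M₀) (θ : ℂ)
    (x : Site) (hx : x ∉ innerDom M₀) : transCoin θ C x = 1 := by
  rw [transCoin, hA1.2 x hx, mul_one]
  refine Matrix.mul_nonsing_inv _ ?_
  rw [Dmat, Matrix.det_diagonal, isUnit_iff_ne_zero, Finset.prod_ne_zero_iff]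
  intro i _
  fin_cases i <;> simp [Complex.exp_ne_zero]

theorem aux_coin_apply {M₀ : ℤ} {C : Site → Matrix Chir Chir ℂ} (hA1 : SatisfiesA1 C M₀) {θ : ℂ}
    {Mθ : H →L[ℂ] H} (hMθ : IsCoinOp Mθ (transCoin θ C)) (u : H)
    (x : Site) (hx : x ∉ innerDom M₀) : (Mθ u) x = u x := by
  ext i
  rw [hMθ, aux_transCoin hA1 θ x hx]
  simp [Matrix.one_apply]

theorem aux_innerDom_finite (M₀ : ℤ) : (innerDom M₀).Finite := by
  refine ((Set.finite_Icc (-M₀) M₀).prod (Set.finite_Icc (-M₀) M₀)).subset ?_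
  rintro ⟨a, b⟩ ⟨h1, h2⟩
  exact ⟨abs_le.1 h1, abs_le.1 h2⟩

/-- An operator whose values are all supported in a finite set has finite rank. -/
theorem aux_finite_rank (K : H →L[ℂ] H) (s : Set Site) (hs : s.Finite)
    (hK : ∀ u x, x ∉ s → (K u) x = 0) : FiniteDimensional ℂ K.toLinearMap.range := by
  have := hs.to_subtype
  let R : K.toLinearMap.range →ₗ[ℂ] (s → V) :=
    { toFun := fun w x => (w : H) x
      map_add' := fun _ _ => rfl
      map_smul' := fun _ _ => rfl }
  refine FiniteDimensional.of_injective R ?_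
  rintro ⟨_, a, rfl⟩ ⟨_, b, rfl⟩ hab
  apply Subtype.ext
  apply lp.ext
  funext x
  by_cases hx : x ∈ s
  · exact congrFun hab ⟨x, hx⟩
  · exact (hK a x hx).trans (hK b x hx).symm

theorem aux_compact {E : Type*} [NormedAddCommGroup E] [NormedSpace ℂ E] (K : E →L[ℂ] E) (h : FiniteDimensional ℂ K.toLinearMap.range) :
    IsCompactOperator K := by
  have : ProperSpace K.toLinearMap.range := FiniteDimensional.proper ℂ _
  refine ⟨Subtype.val '' (Metric.closedBall (0 : K.toLinearMap.range) 1),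
    (isCompact_closedBall _ _).image continuous_subtype_val, ?_⟩
  have h1 : K ⁻¹' (Metric.closedBall 0 1) ∈ nhds (0 : E) := by
    apply K.continuous.continuousAt
    rw [map_zero]
    exact Metric.closedBall_mem_nhds _ one_pos
  filter_upwards [h1] with u hu
  exact ⟨⟨K u, u, rfl⟩, mem_closedBall_zero_iff.2 (mem_closedBall_zero_iff.1 hu), rfl⟩

theorem aux_norm_exp (θ : ℂ) : ‖Complex.exp (-(Complex.I * θ))‖ = Real.exp θ.im := by
  rw [Complex.norm_exp]; simp

theorem aux_tendsto (u : H) (i : Chir) (g : ℕ → Site) (hg : Function.Injective g) :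
    Filter.Tendsto (fun n => ‖u (g n) i‖) Filter.atTop (nhds 0) := by
  have h := ((aux_hasSum_comp u i).comp_injective hg).tendsto_atTop_zero
  have h2 := h.sqrt
  simpa [Function.comp_def] using h2

/-- The circle lies in the spectrum: `U(θ) - z` misses a delta state on a free row. -/
theorem aux_circle
    (M₀ : ℤ) (C : Site → Matrix Chir Chir ℂ) (hA1 : SatisfiesA1 C M₀)
    (S : H →L[ℂ] H) (hS : IsShiftOp S) (θ : ℂ)
    (Mθ : H →L[ℂ] H) (hMθ : IsCoinOp Mθ (transCoin θ C)) (z : ℂ) (hz : ‖z‖ = Real.exp θ.im) :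
    z ∈ spectrum ℂ (transWalkOp θ S Mθ) := by
  intro hu
  obtain ⟨R, hR⟩ := hu.exists_right_inv
  set w : H := deltaState (0, M₀ + 1) 1 with hw
  set v : H := R w with hv
  set c : ℂ := Complex.exp (-(Complex.I * θ)) with hc
  have hcz : ‖c‖ = ‖z‖ := by rw [hz, hc, aux_norm_exp]
  have hc0 : 0 < ‖c‖ := by rw [hc, aux_norm_exp]; exact Real.exp_pos _
  have heq : z • v - transWalkOp θ S Mθ v = w := by
    have := congrArg (fun A : H →L[ℂ] H => A w) hR
    simpa [Algebra.algebraMap_eq_smul_one] using this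
  have hrow : ∀ n : ℤ, z * v (n, M₀ + 1) 1 - c * v (n - 1, M₀ + 1) 1
      = if n = 0 then 1 else 0 := by
    intro n
    have h1 := congrArg (fun f : H => f (n, M₀ + 1) 1) heq
    have h2 : (transWalkOp θ S Mθ v) (n, M₀ + 1) 1 = c * v (n - 1, M₀ + 1) 1 := by
      have h3 := (hS (Mθ v) (n, M₀ + 1)).2.1
      have h4 := aux_coin_apply hA1 hMθ v (n - 1, M₀ + 1) (by
        rintro ⟨_, h⟩
        have := (abs_le.1 h).2
        simp at this)
      simp only at h3
      rw [h4] at h3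
      rw [← h3]
      rfl
    have h5 : (z • v - transWalkOp θ S Mθ v : H) (n, M₀ + 1) 1
      = z * v (n, M₀ + 1) 1 - (transWalkOp θ S Mθ v) (n, M₀ + 1) 1 := rfl
    simp only at h1
    rw [h5, h2] at h1
    rw [h1, hw, deltaState]
    by_cases hn : n = 0
    · subst hn; simp
    · rw [lp.single_apply_ne]
      · simp [hn]
      · simpa using hn
  have hstep : ∀ n : ℤ, n ≠ 0 → ‖v (n, M₀ + 1) 1‖ = ‖v (n - 1, M₀ + 1) 1‖ := by
    intro n hn
    have h := hrow n
    rw [if_neg hn, sub_eq_zero] at h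
    have h' := congrArg norm h
    rw [norm_mul, norm_mul, ← hcz] at h'
    exact mul_left_cancel₀ hc0.ne' h'
  have hpos : ∀ n : ℕ, ‖v ((n : ℤ), M₀ + 1) 1‖ = ‖v (0, M₀ + 1) 1‖ := by
    intro n
    induction n with
    | zero => simp
    | succ k ih =>
      rw [hstep _ (by positivity), ← ih]
      push_cast
      simp
  have hneg : ∀ n : ℕ, ‖v (-(n : ℤ) - 1, M₀ + 1) 1‖ = ‖v (-1, M₀ + 1) 1‖ := by
    intro n
    induction n with
    | zero => simp
    | succ k ih =>
      rw [← ih, hstep (-(k : ℤ) - 1) (by omega)]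
      have e : (-((k + 1 : ℕ) : ℤ) - 1) = -(k : ℤ) - 1 - 1 := by
        push_cast
        ring
      rw [e]
  have z1 : ‖v (0, M₀ + 1) 1‖ = 0 := by
    have h := aux_tendsto v 1 (fun n : ℕ => ((n : ℤ), M₀ + 1)) (by
      intro a b hab
      simpa using hab)
    simp only [hpos] at h
    exact tendsto_nhds_unique tendsto_const_nhds h
  have z2 : ‖v (-1, M₀ + 1) 1‖ = 0 := by
    have h := aux_tendsto v 1 (fun n : ℕ => (-(n : ℤ) - 1, M₀ + 1)) (by
      intro a b hab
      simpa using hab)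
    simp only [hneg] at h
    exact tendsto_nhds_unique tendsto_const_nhds h
  have h0 := hrow 0
  rw [norm_eq_zero] at z1 z2
  rw [zero_sub, z1, z2] at h0
  simp at h0

/-- Off the circle, spectral points are eigenvalues of finite multiplicity. -/
theorem aux_off_circle
    (M₀ : ℤ) (C : Site → Matrix Chir Chir ℂ) (hA1 : SatisfiesA1 C M₀)
    (S : H →L[ℂ] H) (hS : IsShiftOp S) (θ : ℂ)
    (Mθ : H →L[ℂ] H) (hMθ : IsCoinOp Mθ (transCoin θ C)) (z : ℂ) (hz : ‖z‖ ≠ Real.exp θ.im)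
    (hsp : z ∈ spectrum ℂ (transWalkOp θ S Mθ)) :
    (∃ u : H, u ≠ 0 ∧ (transWalkOp θ S Mθ) u = z • u) ∧
      FiniteDimensional ℂ (Module.End.eigenspace (↑(transWalkOp θ S Mθ) : H →ₗ[ℂ] H) z) := by
  set c : ℂ := Complex.exp (-(Complex.I * θ)) with hc
  have hcn : ‖c‖ = Real.exp θ.im := aux_norm_exp θ
  have hc0 : c ≠ 0 := Complex.exp_ne_zero _
  set K : H →L[ℂ] H := Mθ - 1 with hKdef
  have hKfin : FiniteDimensional ℂ K.toLinearMap.range := by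
    refine aux_finite_rank K (innerDom M₀) (aux_innerDom_finite M₀) fun u x hx => ?_
    have h1 : (K u) x = (Mθ u) x - u x := rfl
    rw [h1, aux_coin_apply hA1 hMθ u x hx, sub_self]
  have hA : IsUnit (algebraMap ℂ (H →L[ℂ] H) z - c • S) := by
    have h1 : c⁻¹ * z ∉ spectrum ℂ S := by
      intro h
      have h2 := spectrum.subset_circle_of_unitary (aux_shift_unitary hS) h
      rw [mem_sphere_zero_iff_norm, norm_mul, norm_inv, inv_mul_eq_one₀ (by simpa using hc0)] at h2
      exact hz (h2.symm.trans hcn)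
    have h2 : IsUnit (algebraMap ℂ (H →L[ℂ] H) (c⁻¹ * z) - S) := by
      simpa [spectrum.mem_iff] using h1
    have h3 := h2.smul (Units.mk0 c hc0)
    convert h3 using 1
    rw [Units.smul_def, Units.val_mk0, smul_sub, Algebra.algebraMap_eq_smul_one,
      Algebra.algebraMap_eq_smul_one, smul_smul, mul_inv_cancel_left₀ hc0]
  obtain ⟨A, hAe⟩ := hA
  set B : H →L[ℂ] H := (↑A⁻¹ : H →L[ℂ] H) * (c • S) with hB
  set T : H →L[ℂ] H := B * K with hT
  have hTfin : FiniteDimensional ℂ T.toLinearMap.range := by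
    have : T.toLinearMap.range = K.toLinearMap.range.map B.toLinearMap := by
      rw [hT]
      exact LinearMap.range_comp _ _
    rw [this]
    infer_instance
  have hU : transWalkOp θ S Mθ = c • S + (c • S) * K := by
    rw [hKdef, mul_sub, mul_one, add_sub_cancel, smul_mul_assoc]
    rfl
  have hfac : algebraMap ℂ (H →L[ℂ] H) z - transWalkOp θ S Mθ
      = (A : H →L[ℂ] H) * (1 - T) := by
    rw [mul_sub, mul_one, hT, hB, ← mul_assoc, ← mul_assoc, Units.mul_inv, one_mul, hU, hAe]
    abel
  have hiff : ∀ u : H, transWalkOp θ S Mθ u = z • u ↔ T u = u := by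
    intro u
    have h1 : z • u - transWalkOp θ S Mθ u = (A : H →L[ℂ] H) (u - T u) := by
      have := congrArg (fun Q : H →L[ℂ] H => Q u) hfac
      simpa [Algebra.algebraMap_eq_smul_one] using this
    constructor
    · intro h
      rw [h, sub_self] at h1
      have h2 : (↑A⁻¹ : H →L[ℂ] H) ((A : H →L[ℂ] H) (u - T u)) = u - T u := by
        have := congrArg (fun Q : H →L[ℂ] H => Q (u - T u)) (Units.inv_mul A)
        exact this
      rw [← h1, map_zero] at h2
      exact (sub_eq_zero.1 h2.symm).symm
    · intro h
      rw [h, sub_self, map_zero] at h1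
      exact (sub_eq_zero.1 h1).symm
  constructor
  · rcases (aux_compact T hTfin).hasEigenvalue_or_mem_resolventSet (μ := (1 : ℂ)) one_ne_zero
      with h | h
    · obtain ⟨u, hu⟩ := h.exists_hasEigenvector
      refine ⟨u, hu.2, (hiff u).2 ?_⟩
      simpa using hu.apply_eq_smul
    · exfalso
      apply hsp
      have h1 : IsUnit (1 - T) := by
        have h2 : IsUnit (algebraMap ℂ (H →L[ℂ] H) 1 - T) := h
        rwa [map_one] at h2
      change IsUnit (algebraMap ℂ (H →L[ℂ] H) z - transWalkOp θ S Mθ)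
      rw [hfac]
      exact A.isUnit.mul h1
  · refine Submodule.finiteDimensional_of_le (S₂ := T.toLinearMap.range) ?_
    intro u hu
    exact ⟨u, (hiff u).1 (Module.End.mem_eigenspace_iff.1 hu)⟩

/-- the essential spectrum of `U(θ)` is the circle of radius `e^{Im θ}`. -/
theorem translated_walk_essential_spectrum
    (M₀ : ℤ) (C : Site → Matrix Chir Chir ℂ)
    (hC : IsUnitaryCoin C) (hA1 : SatisfiesA1 C M₀)
    (S : H →L[ℂ] H) (hS : IsShiftOp S)
    (θ : ℂ) (hθ : θ.im < 0)
    (Mθ : H →L[ℂ] H) (hMθ : IsCoinOp Mθ (transCoin θ C)) :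
    {z : ℂ | ‖z‖ = Real.exp θ.im} ⊆ spectrum ℂ (transWalkOp θ S Mθ) ∧
    ∀ z : ℂ, ‖z‖ ≠ Real.exp θ.im → z ∈ spectrum ℂ (transWalkOp θ S Mθ) →
      (∃ u : H, u ≠ 0 ∧ (transWalkOp θ S Mθ) u = z • u) ∧
      FiniteDimensional ℂ (Module.End.eigenspace (↑(transWalkOp θ S Mθ) : H →ₗ[ℂ] H) z) := by
  exact ⟨fun z hz => aux_circle M₀ C hA1 S hS θ Mθ hMθ z hz,
    fun z hz hsp => aux_off_circle M₀ C hA1 S hS θ Mθ hMθ z hz hsp⟩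

end QWPaper
end
end

section
/- For the four-corner elastic quantum walk U_el, the set of eigenvalues of U_el is exactly {e^{−iπk/(m₀+n₀)} : k = 0, 1, …, 2(m₀+n₀)−1}, and each eigenvalue has a two-dimensional eigenspace. -/
noncomputable section

namespace QWPaper

open Complex

/-- Explicit form of the coin action, component by component. -/
def fcSel (m n : ℤ) (v : ℤ → ℤ → Fin 4 → ℂ) (a b c d e : Fin 4) (x y : ℤ) : ℂ :=
  if x = 0 ∧ y = 0 then v x y a else if x = m ∧ y = 0 then v x y b
  else if x = m ∧ y = n then v x y c else if x = 0 ∧ y = n then v x y d else v x y e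

/-- Pointwise eigenvalue equations. -/
structure FCEq (m n : ℤ) (z : ℂ) (v : ℤ → ℤ → Fin 4 → ℂ) : Prop where
  e0 : ∀ x y, fcSel m n v 1 2 3 1 0 (x + 1) y = z * v x y 0
  e1 : ∀ x y, fcSel m n v 2 0 0 3 1 (x - 1) y = z * v x y 1
  e2 : ∀ x y, fcSel m n v 3 3 1 0 2 x (y + 1) = z * v x y 2
  e3 : ∀ x y, fcSel m n v 0 1 2 2 3 x (y - 1) = z * v x y 3

theorem fc_coin (m n : ℤ) (v : ℤ → ℤ → Fin 4 → ℂ) (x y : ℤ) :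
    (∑ j : Chir, fourCornerCoin m n (x, y) 0 j * v x y j = fcSel m n v 1 2 3 1 0 x y) ∧
    (∑ j : Chir, fourCornerCoin m n (x, y) 1 j * v x y j = fcSel m n v 2 0 0 3 1 x y) ∧
    (∑ j : Chir, fourCornerCoin m n (x, y) 2 j * v x y j = fcSel m n v 3 3 1 0 2 x y) ∧
    (∑ j : Chir, fourCornerCoin m n (x, y) 3 j * v x y j = fcSel m n v 0 1 2 2 3 x y) := by
  unfold fourCornerCoin fcSel
  simp only [Prod.mk.injEq]
  split_ifs <;> simp [Fin.sum_univ_four, Matrix.one_apply]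

theorem fc_iff (m n : ℤ) (S Cop : H →L[ℂ] H) (hS : IsShiftOp S)
    (hCop : IsCoinOp Cop (fourCornerCoin m n)) (z : ℂ) (u : H) :
    (S.comp Cop) u = z • u ↔ FCEq m n z (fun x y i => u (x, y) i) := by
  have key : ∀ x y,
      ((S.comp Cop) u) (x, y) 0 = fcSel m n (fun x y i => u (x, y) i) 1 2 3 1 0 (x + 1) y ∧
      ((S.comp Cop) u) (x, y) 1 = fcSel m n (fun x y i => u (x, y) i) 2 0 0 3 1 (x - 1) y ∧
      ((S.comp Cop) u) (x, y) 2 = fcSel m n (fun x y i => u (x, y) i) 3 3 1 0 2 x (y + 1) ∧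
      ((S.comp Cop) u) (x, y) 3 = fcSel m n (fun x y i => u (x, y) i) 0 1 2 2 3 x (y - 1) := by
    intro x y
    obtain ⟨h0, h1, h2, h3⟩ := hS (Cop u) (x, y)
    refine ⟨h0.trans ?_, h1.trans ?_, h2.trans ?_, h3.trans ?_⟩
    · rw [hCop]; exact (fc_coin m n (fun x y i => u (x, y) i) _ _).1
    · rw [hCop]; exact (fc_coin m n (fun x y i => u (x, y) i) _ _).2.1
    · rw [hCop]; exact (fc_coin m n (fun x y i => u (x, y) i) _ _).2.2.1
    · rw [hCop]; exact (fc_coin m n (fun x y i => u (x, y) i) _ _).2.2.2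
  have smul_ap : ∀ (x : Site) (i : Fin 4), (z • u : H) x i = z * u x i := by
    intro x i
    simp
  constructor
  · intro h
    refine ⟨?_, ?_, ?_, ?_⟩
    · intro x y; rw [← (key x y).1, h, smul_ap]
    · intro x y; rw [← (key x y).2.1, h, smul_ap]
    · intro x y; rw [← (key x y).2.2.1, h, smul_ap]
    · intro x y; rw [← (key x y).2.2.2, h, smul_ap]
  · rintro ⟨e0, e1, e2, e3⟩
    ext ⟨x, y⟩ i
    rw [smul_ap]
    fin_cases i
    · exact (key x y).1.trans (e0 x y)
    · exact (key x y).2.1.trans (e1 x y)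
    · exact (key x y).2.2.1.trans (e2 x y)
    · exact (key x y).2.2.2.trans (e3 x y)

theorem fc_vanish (u : H) (i : Fin 4) (w : ℕ → Site) (hw : Function.Injective w)
    (h : ∀ k, ‖u (w (k + 1)) i‖ = ‖u (w k) i‖) : u (w 0) i = 0 := by
  have hs := (Memℓp.summable (p := 2) (by simp) (lp.memℓp u)).comp_injective hw
  have h0 : ∀ k, ‖u (w k) i‖ = ‖u (w 0) i‖ := by
    intro k
    induction k with
    | zero => rfl
    | succ k ih => rw [h, ih]
  have ht := hs.tendsto_atTop_zero
  have hle : ∀ k, ‖u (w 0) i‖ ^ 2 ≤ ((fun x => ‖u x‖ ^ (2 : ENNReal).toReal) ∘ w) k := by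
    intro k
    rw [← h0 k]
    simp only [Function.comp, ENNReal.toReal_ofNat, Real.rpow_ofNat]
    gcongr
    exact PiLp.norm_apply_le _ _
  have := ge_of_tendsto' ht hle
  have h2 : ‖u (w 0) i‖ = 0 := by
    have := norm_nonneg (u (w 0) i)
    nlinarith
  simpa using h2

theorem fc_chain (z : ℂ) (f : ℕ → ℂ) (K : ℕ) (h : ∀ k < K, f (k + 1) = z * f k) :
    ∀ k ≤ K, f k = z ^ k * f 0 := by
  intro k
  induction k with
  | zero => simp
  | succ k ih =>
    intro hk
    rw [h k (by omega), ih (by omega), pow_succ]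
    ring

/-- A chain of `K` free steps followed by a corner step. -/
theorem fc_edge (z : ℂ) (f : ℕ → ℂ) (g : ℂ) (K : ℕ) (hK : 1 ≤ K)
    (h : ∀ k, k + 1 < K → f (k + 1) = z * f k) (hg : g = z * f (K - 1)) :
    (∀ k < K, f k = z ^ k * f 0) ∧ g = z ^ K * f 0 := by
  obtain ⟨K, rfl⟩ : ∃ L, K = L + 1 := ⟨K - 1, by omega⟩
  have := fc_chain z f K (fun k hk => h k (by omega))
  refine ⟨fun k hk => this k (by omega), ?_⟩
  rw [hg, Nat.add_sub_cancel, this K le_rfl, pow_succ]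
  ring

theorem fc_edges (m n : ℕ) (hm : 1 ≤ m) (hn : 1 ≤ n) (z : ℂ) (v : ℤ → ℤ → Fin 4 → ℂ)
    (h : FCEq m n z v) :
    (((∀ k < m, v k 0 0 = z ^ k * v 0 0 0) ∧ v m 0 2 = z ^ m * v 0 0 0) ∧
    ((∀ k < n, v m k 2 = z ^ k * v m 0 2) ∧ v m n 1 = z ^ n * v m 0 2) ∧
    ((∀ k < m, v (m - k) n 1 = z ^ k * v m n 1) ∧ v 0 n 3 = z ^ m * v m n 1) ∧
    ((∀ k < n, v 0 (n - k) 3 = z ^ k * v 0 n 3) ∧ v 0 0 0 = z ^ n * v 0 n 3)) ∧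
    (((∀ k < n, v 0 k 2 = z ^ k * v 0 0 2) ∧ v 0 n 0 = z ^ n * v 0 0 2) ∧
    ((∀ k < m, v k n 0 = z ^ k * v 0 n 0) ∧ v m n 3 = z ^ m * v 0 n 0) ∧
    ((∀ k < n, v m (n - k) 3 = z ^ k * v m n 3) ∧ v m 0 1 = z ^ n * v m n 3) ∧
    ((∀ k < m, v (m - k) 0 1 = z ^ k * v m 0 1) ∧ v 0 0 2 = z ^ m * v m 0 1)) := by
  obtain ⟨e0, e1, e2, e3⟩ := h
  unfold fcSel at e0 e1 e2 e3
  refine ⟨⟨?_, ?_, ?_, ?_⟩, ?_, ?_, ?_, ?_⟩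
  · have := fc_edge z (fun k => v k 0 0) (v m 0 2) m hm
      (fun k hk => by have := e0 k 0; grind) (by have := e0 (m - 1 : ℕ) 0; grind)
    simpa using this
  · have := fc_edge z (fun k => v m k 2) (v m n 1) n hn
      (fun k hk => by have := e2 m k; grind) (by have := e2 m (n - 1 : ℕ); grind)
    simpa using this
  · have := fc_edge z (fun k => v (m - k) n 1) (v 0 n 3) m hm
      (fun k hk => by have := e1 (m - k) n; grind) (by have := e1 (m - (m - 1 : ℕ)) n; grind)
    simpa using this
  · have := fc_edge z (fun k => v 0 (n - k) 3) (v 0 0 0) n hn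
      (fun k hk => by have := e3 0 (n - k); grind) (by have := e3 0 (n - (n - 1 : ℕ)); grind)
    simpa using this
  · have := fc_edge z (fun k => v 0 k 2) (v 0 n 0) n hn
      (fun k hk => by have := e2 0 k; grind) (by have := e2 0 (n - 1 : ℕ); grind)
    simpa using this
  · have := fc_edge z (fun k => v k n 0) (v m n 3) m hm
      (fun k hk => by have := e0 k n; grind) (by have := e0 (m - 1 : ℕ) n; grind)
    simpa using this
  · have := fc_edge z (fun k => v m (n - k) 3) (v m 0 1) n hn
      (fun k hk => by have := e3 m (n - k); grind) (by have := e3 m (n - (n - 1 : ℕ)); grind)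
    simpa using this
  · have := fc_edge z (fun k => v (m - k) 0 1) (v 0 0 2) m hm
      (fun k hk => by have := e1 (m - k) 0; grind) (by have := e1 (m - (m - 1 : ℕ)) 0; grind)
    simpa using this

theorem fcSel_free (m n : ℤ) (v : ℤ → ℤ → Fin 4 → ℂ) (a b c d e : Fin 4) (x y : ℤ)
    (h : ¬ ((x = 0 ∨ x = m) ∧ (y = 0 ∨ y = n))) : fcSel m n v a b c d e x y = v x y e := by
  unfold fcSel
  rw [if_neg (by omega), if_neg (by omega), if_neg (by omega), if_neg (by omega)]

theorem fc_zero (m n : ℕ) (hm : 1 ≤ m) (hn : 1 ≤ n) (z : ℂ) (hz : ‖z‖ = 1) (u : H)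
    (h : FCEq m n z (fun x y i => u (x, y) i)) (x y : ℤ) :
    (¬ ((y = 0 ∨ y = n) ∧ 0 ≤ x ∧ x < m) → u (x, y) 0 = 0) ∧
    (¬ ((y = 0 ∨ y = n) ∧ 0 < x ∧ x ≤ m) → u (x, y) 1 = 0) ∧
    (¬ ((x = 0 ∨ x = m) ∧ 0 ≤ y ∧ y < n) → u (x, y) 2 = 0) ∧
    (¬ ((x = 0 ∨ x = m) ∧ 0 < y ∧ y ≤ n) → u (x, y) 3 = 0) := by
  obtain ⟨e0, e1, e2, e3⟩ := h
  have hnorm : ∀ a b : ℂ, a = z * b → ‖a‖ = ‖b‖ := by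
    rintro a b rfl; simp [hz]
  have hR : ∀ i : Fin 4, (∀ k : ℕ, ‖u (x + k + 1, y) i‖ = ‖u (x + k, y) i‖) →
      u (x, y) i = 0 := by
    intro i hk
    have := fc_vanish u i (fun k => (x + k, y)) (fun a b hab => by simpa using hab)
      (fun k => by have := hk k; push_cast; rw [← add_assoc]; exact this)
    simpa using this
  have hL : ∀ i : Fin 4, (∀ k : ℕ, ‖u (x - k - 1, y) i‖ = ‖u (x - k, y) i‖) →
      u (x, y) i = 0 := by
    intro i hk
    have := fc_vanish u i (fun k => (x - k, y)) (fun a b hab => by simpa using hab)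
      (fun k => by have := hk k; push_cast; rw [← sub_sub]; exact this)
    simpa using this
  have hU : ∀ i : Fin 4, (∀ k : ℕ, ‖u (x, y + k + 1) i‖ = ‖u (x, y + k) i‖) →
      u (x, y) i = 0 := by
    intro i hk
    have := fc_vanish u i (fun k => (x, y + k)) (fun a b hab => by simpa using hab)
      (fun k => by have := hk k; push_cast; rw [← add_assoc]; exact this)
    simpa using this
  have hD : ∀ i : Fin 4, (∀ k : ℕ, ‖u (x, y - k - 1) i‖ = ‖u (x, y - k) i‖) →
      u (x, y) i = 0 := by
    intro i hk
    have := fc_vanish u i (fun k => (x, y - k)) (fun a b hab => by simpa using hab)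
      (fun k => by have := hk k; push_cast; rw [← sub_sub]; exact this)
    simpa using this
  refine ⟨fun hc => ?_, fun hc => ?_, fun hc => ?_, fun hc => ?_⟩
  · by_cases hx : x < 0
    · refine hL 0 fun k => (hnorm _ _ ?_).symm
      have := e0 (x - k - 1) y
      rw [fcSel_free _ _ _ _ _ _ _ _ _ _ (by omega)] at this
      simpa using this
    · refine hR 0 fun k => hnorm _ _ ?_
      have := e0 (x + k) y
      rw [fcSel_free _ _ _ _ _ _ _ _ _ _ (by omega)] at this
      simpa using this
  · by_cases hx : 0 < x
    · refine hR 1 fun k => (hnorm _ _ ?_).symm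
      have := e1 (x + k + 1) y
      rw [fcSel_free _ _ _ _ _ _ _ _ _ _ (by omega)] at this
      simpa using this
    · refine hL 1 fun k => hnorm _ _ ?_
      have := e1 (x - k) y
      rw [fcSel_free _ _ _ _ _ _ _ _ _ _ (by omega)] at this
      simpa using this
  · by_cases hx : y < 0
    · refine hD 2 fun k => (hnorm _ _ ?_).symm
      have := e2 x (y - k - 1)
      rw [fcSel_free _ _ _ _ _ _ _ _ _ _ (by omega)] at this
      simpa using this
    · refine hU 2 fun k => hnorm _ _ ?_
      have := e2 x (y + k)
      rw [fcSel_free _ _ _ _ _ _ _ _ _ _ (by omega)] at this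
      simpa using this
  · by_cases hx : 0 < y
    · refine hU 3 fun k => (hnorm _ _ ?_).symm
      have := e3 x (y + k + 1)
      rw [fcSel_free _ _ _ _ _ _ _ _ _ _ (by omega)] at this
      simpa using this
    · refine hD 3 fun k => hnorm _ _ ?_
      have := e3 x (y - k)
      rw [fcSel_free _ _ _ _ _ _ _ _ _ _ (by omega)] at this
      simpa using this

theorem fc_inj (m n : ℕ) (hm : 1 ≤ m) (hn : 1 ≤ n) (z : ℂ) (hz : ‖z‖ = 1) (u : H)
    (h : FCEq m n z (fun x y i => u (x, y) i)) (h0 : u (0, 0) 0 = 0) (h2 : u (0, 0) 2 = 0) :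
    u = 0 := by
  obtain ⟨⟨⟨a1, b1⟩, ⟨a2, b2⟩, ⟨a3, b3⟩, ⟨a4, b4⟩⟩, ⟨c1, d1⟩, ⟨c2, d2⟩, ⟨c3, d3⟩, ⟨c4, d4⟩⟩ :=
    fc_edges m n hm hn z _ h
  simp only [h0, h2, mul_zero] at b1 d1 a1 c1
  simp only [b1, d1, mul_zero] at b2 d2 a2 c2
  simp only [b2, d2, mul_zero] at b3 d3 a3 c3
  simp only [b3, d3, mul_zero] at a4 c4
  ext ⟨x, y⟩ i
  obtain ⟨z0, z1, z2, z3⟩ := fc_zero m n hm hn z hz u h x y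
  change u (x, y) i = 0
  fin_cases i
  · change u (x, y) 0 = 0
    by_cases hc : ((y = 0 ∨ y = n) ∧ 0 ≤ x ∧ x < m)
    · obtain ⟨hy, hx0, hx⟩ := hc
      lift x to ℕ using hx0
      rcases hy with rfl | rfl
      · exact a1 x (by omega)
      · exact c2 x (by omega)
    · exact z0 hc
  · change u (x, y) 1 = 0
    by_cases hc : ((y = 0 ∨ y = n) ∧ 0 < x ∧ x ≤ m)
    · obtain ⟨hy, hx0, hx⟩ := hc
      obtain ⟨k, rfl⟩ : ∃ k : ℕ, x = m - k := ⟨(m - x).toNat, by omega⟩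
      rcases hy with rfl | rfl
      · exact c4 k (by omega)
      · exact a3 k (by omega)
    · exact z1 hc
  · change u (x, y) 2 = 0
    by_cases hc : ((x = 0 ∨ x = m) ∧ 0 ≤ y ∧ y < n)
    · obtain ⟨hy, hx0, hx⟩ := hc
      lift y to ℕ using hx0
      rcases hy with rfl | rfl
      · exact c1 y (by omega)
      · exact a2 y (by omega)
    · exact z2 hc
  · change u (x, y) 3 = 0
    by_cases hc : ((x = 0 ∨ x = m) ∧ 0 < y ∧ y ≤ n)
    · obtain ⟨hy, hx0, hx⟩ := hc
      obtain ⟨k, rfl⟩ : ∃ k : ℕ, y = n - k := ⟨(n - y).toNat, by omega⟩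
      rcases hy with rfl | rfl
      · exact a4 k (by omega)
      · exact c3 k (by omega)
    · exact z3 hc

theorem fc_root (m n : ℕ) (hm : 1 ≤ m) (hn : 1 ≤ n) (z : ℂ) (hz : ‖z‖ = 1) (u : H)
    (h : FCEq m n z (fun x y i => u (x, y) i)) (hu : u ≠ 0) : z ^ (2 * (m + n)) = 1 := by
  obtain ⟨⟨⟨-, b1⟩, ⟨-, b2⟩, ⟨-, b3⟩, ⟨-, b4⟩⟩, ⟨-, d1⟩, ⟨-, d2⟩, ⟨-, d3⟩, ⟨-, d4⟩⟩ :=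
    fc_edges m n hm hn z _ h
  rw [b3, b2, b1] at b4
  rw [d3, d2, d1] at d4
  by_contra hne
  have aux : ∀ a : ℂ, a = z ^ (2 * (m + n)) * a → a = 0 := by
    intro a ha
    have : (z ^ (2 * (m + n)) - 1) * a = 0 := by linear_combination -ha
    rcases mul_eq_zero.mp this with h' | h'
    · exact absurd (sub_eq_zero.mp h') hne
    · exact h'
  refine hu (fc_inj m n hm hn z hz u h (aux _ ?_) (aux _ ?_))
  · refine b4.trans ?_; ring
  · refine d4.trans ?_; ring

/-- The explicit eigenfunctions. -/
def fcSol (m n : ℤ) (z a b : ℂ) (x y : ℤ) : Fin 4 → ℂ :=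
  ![if 0 ≤ x ∧ x < m then
      (if y = 0 then a * z ^ x else if y = n then b * z ^ (n + x) else 0) else 0,
    if 0 < x ∧ x ≤ m then
      (if y = n then a * z ^ (2 * m + n - x) else
        if y = 0 then b * z ^ (2 * n + 2 * m - x) else 0) else 0,
    if 0 ≤ y ∧ y < n then
      (if x = m then a * z ^ (m + y) else if x = 0 then b * z ^ y else 0) else 0,
    if 0 < y ∧ y ≤ n then
      (if x = 0 then a * z ^ (2 * m + 2 * n - y) else
        if x = m then b * z ^ (2 * n + m - y) else 0) else 0]

set_option maxHeartbeats 4000000 in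
theorem fcSol_eq (m n : ℤ) (hm : 1 ≤ m) (hn : 1 ≤ n) (z a b : ℂ) (hz : z ≠ 0)
    (hN : z ^ (2 * (m + n)) = 1) : FCEq m n z (fcSol m n z a b) := by
  have hs : ∀ (c : ℂ) (k l : ℤ), k = l + 1 → c * z ^ k = z * (c * z ^ l) := by
    rintro c k l rfl
    rw [zpow_add_one₀ hz]; ring
  have hp : ∀ (c : ℂ) (k l : ℤ), k + 2 * (m + n) = l + 1 → c * z ^ k = z * (c * z ^ l) := by
    intro c k l hkl
    rw [← hs c _ l hkl, zpow_add₀ hz, hN, mul_one]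
  constructor
  all_goals
    intro x y
    simp only [fcSel, fcSol, Matrix.cons_val]
    split_ifs
    all_goals first
      | omega
      | rw [mul_zero]
      | (apply hs; omega)
      | (apply hp; omega)

theorem fc_exists (m n : ℤ) (hm : 1 ≤ m) (hn : 1 ≤ n) (z a b : ℂ) (hz : z ≠ 0)
    (hN : z ^ (2 * (m + n)) = 1) :
    ∃ u : H, FCEq m n z (fun x y i => u (x, y) i) ∧ u (0, 0) 0 = a ∧ u (0, 0) 2 = b := by
  let f : Site → V := fun x => WithLp.toLp 2 (fcSol m n z a b x.1 x.2)
  have hf : Memℓp f 2 := by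
    refine (memℓp_zero ?_).of_exponent_ge (by simp)
    refine (Set.finite_Icc ((0, 0) : Site) (m, n)).subset ?_
    rintro ⟨x, y⟩ hxy
    by_contra hc
    apply hxy
    simp only [Set.mem_Icc, Prod.mk_le_mk] at hc
    ext i
    simp only [f, fcSol]
    fin_cases i <;> simp <;> grind
  refine ⟨⟨f, hf⟩, fcSol_eq m n hm hn z a b hz hN, ?_, ?_⟩
  · change fcSol m n z a b 0 0 0 = a
    simp [fcSol]; omega
  · change fcSol m n z a b 0 0 2 = b
    simp [fcSol]; grind

theorem fc_roots (m n : ℕ) (hm : 1 ≤ m) (z : ℂ) :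
    z ^ (2 * (m + n)) = 1 ↔ ∃ k : ℕ, (k : ℤ) < 2 * ((m : ℤ) + n) ∧
      z = Complex.exp (-(Complex.I * (Real.pi : ℂ) * (k : ℂ) / ((m : ℂ) + (n : ℂ)))) := by
  have hN : 2 * (m + n) ≠ 0 := by omega
  have hne : (m : ℂ) + n ≠ 0 := by
    have : m + n ≠ 0 := by omega
    exact_mod_cast this
  have : NeZero (2 * (m + n)) := ⟨hN⟩
  have hprim := (Complex.isPrimitiveRoot_exp _ hN).inv
  have hform : ∀ k : ℕ, (Complex.exp (2 * Real.pi * Complex.I / (2 * (m + n) : ℕ)))⁻¹ ^ k =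
      Complex.exp (-(Complex.I * (Real.pi : ℂ) * (k : ℂ) / ((m : ℂ) + (n : ℂ)))) := by
    intro k
    rw [← Complex.exp_neg, ← Complex.exp_nat_mul]
    congr 1
    push_cast
    field_simp
  constructor
  · intro h
    obtain ⟨k, hk, rfl⟩ := hprim.eq_pow_of_pow_eq_one h
    exact ⟨k, by omega, hform k⟩
  · rintro ⟨k, -, rfl⟩
    rw [← hform, pow_right_comm, hprim.pow_eq_one, one_pow]

/-- the eigenvalues of the four-corner elastic walk are exactly
`e^{−iπk/(m₀+n₀)}`, `k = 0, …, 2(m₀+n₀)−1`, each with a two-dimensional eigenspace. -/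
theorem fourCorner_eigenvalues
    (m₀ n₀ : ℤ) (hm : 1 ≤ m₀) (hn : 1 ≤ n₀)
    (S Cop : H →L[ℂ] H) (hS : IsShiftOp S) (hCop : IsCoinOp Cop (fourCornerCoin m₀ n₀))
    (hUnit : S.comp Cop ∈ unitary (H →L[ℂ] H)) :
    {z : ℂ | ∃ u : H, u ≠ 0 ∧ (S.comp Cop) u = z • u} =
      {z : ℂ | ∃ k : ℕ, (k : ℤ) < 2 * (m₀ + n₀) ∧
        z = Complex.exp (-(Complex.I * (Real.pi : ℂ) * (k : ℂ) / ((m₀ : ℂ) + (n₀ : ℂ))))} ∧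
    ∀ z : ℂ, (∃ u : H, u ≠ 0 ∧ (S.comp Cop) u = z • u) →
      Module.finrank ℂ (Module.End.eigenspace (↑(S.comp Cop) : H →ₗ[ℂ] H) z) = 2 := by
  lift m₀ to ℕ using by omega
  lift n₀ to ℕ using by omega
  have hm' : 1 ≤ m₀ := by omega
  have hn' : 1 ≤ n₀ := by omega
  have iff := fc_iff m₀ n₀ S Cop hS hCop
  have hz1 : ∀ (z : ℂ) (u : H), u ≠ 0 → (S.comp Cop) u = z • u → ‖z‖ = 1 := by
    intro z u hu h
    have h1 : ‖(S.comp Cop) u‖ = ‖u‖ := Unitary.norm_map ⟨S.comp Cop, hUnit⟩ u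
    rw [h, norm_smul] at h1
    exact (mul_eq_right₀ (norm_ne_zero_iff.mpr hu)).mp h1
  have hroot : ∀ z : ℂ, (∃ u : H, u ≠ 0 ∧ (S.comp Cop) u = z • u) → z ^ (2 * (m₀ + n₀)) = 1 := by
    rintro z ⟨u, hu, h⟩
    exact fc_root m₀ n₀ hm' hn' z (hz1 z u hu h) u ((iff z u).1 h) hu
  have hex : ∀ z : ℂ, z ^ (2 * (m₀ + n₀)) = 1 → ∀ a b : ℂ, ∃ u : H,
      (S.comp Cop) u = z • u ∧ u (0, 0) 0 = a ∧ u (0, 0) 2 = b := by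
    intro z hz a b
    have hz0 : z ≠ 0 := by
      rintro rfl
      rw [zero_pow (by omega)] at hz
      exact zero_ne_one hz
    obtain ⟨u, h, ha, hb⟩ := fc_exists m₀ n₀ hm hn z a b hz0 (by exact_mod_cast hz)
    exact ⟨u, (iff z u).2 h, ha, hb⟩
  refine ⟨?_, ?_⟩
  · ext z
    simp only [Set.mem_ofPred_eq]
    have hr := fc_roots m₀ n₀ hm' z
    rw [Int.cast_natCast, Int.cast_natCast, ← hr]
    refine ⟨hroot z, fun h => ?_⟩
    obtain ⟨u, hu, ha, -⟩ := hex z h 1 0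
    refine ⟨u, ?_, hu⟩
    rintro rfl
    exact zero_ne_one ha
  · intro z hzu
    have hr := hroot z hzu
    obtain ⟨u₀, hu₀, h₀⟩ := hzu
    have hz := hz1 z u₀ hu₀ h₀
    let ev : Module.End.eigenspace (↑(S.comp Cop) : H →ₗ[ℂ] H) z →ₗ[ℂ] (Fin 2 → ℂ) :=
      { toFun := fun u => ![(u : H) (0, 0) 0, (u : H) (0, 0) 2]
        map_add' := by
          intro u w
          ext i
          fin_cases i <;> rfl
        map_smul' := by
          intro c u
          ext i
          fin_cases i <;> rfl }
    have hinj : Function.Injective ev := by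
      rw [← LinearMap.ker_eq_bot, LinearMap.ker_eq_bot']
      rintro ⟨u, hu⟩ hev
      have hu' : (S.comp Cop) u = z • u := Module.End.mem_eigenspace_iff.mp hu
      have e0 : u (0, 0) 0 = 0 := congrFun hev 0
      have e2 : u (0, 0) 2 = 0 := congrFun hev 1
      exact Subtype.ext (fc_inj m₀ n₀ hm' hn' z hz u ((iff z u).1 hu') e0 e2)
    have hsurj : Function.Surjective ev := by
      intro c
      obtain ⟨u, hu, ha, hb⟩ := hex z hr (c 0) (c 1)
      refine ⟨⟨u, Module.End.mem_eigenspace_iff.mpr hu⟩, ?_⟩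
      ext i
      fin_cases i
      · exact ha
      · exact hb
    rw [(LinearEquiv.ofBijective ev ⟨hinj, hsurj⟩).finrank_eq]
    simp

end QWPaper
end
end

section
/- Fix ε ∈ (0,1] and let U_ε be a perturbed four-corner quantum walk. (i) There exists an eigenvalue of U_ε with an eigenfunction supported on the image of the closed trajectory Φ₊ if and only if |c_ε⁺| = 1; in that case these eigenvalues are exactly the 2(m₀+n₀) numbers e^{−iκ} with κ ∈ ℝ satisfying e^{−2i(m₀+n₀)κ} = c_ε⁺. (ii) If |c_ε⁺| < 1, then for every κ ∈ ℂ with Im κ < 0 satisfying e^{−2i(m₀+n₀)κ} = c_ε⁺ there exists a nonzero outgoing solution u of U_ε u = e^{−iκ}u, supported on the union of the image of Φ₊ and the eight outgoing tails {((−N,y₂),←) : N ≥ 1}, {((y₁,n₀+N),↑) : N ≥ 1}, {((y₁,−N),↓) : N ≥ 1}, {((m₀+N,y₂),→) : N ≥ 1} for y₁ ∈ {0,m₀}, y₂ ∈ {0,n₀}. -/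
noncomputable section

namespace QWPaper

open Complex

/-- The candidate (resonant) state along `Φ₊`. -/
def sol (m n : ℤ) (C : Site → Matrix Chir Chir ℂ) (z a2 a3 a4 : ℂ) (x : Site) : Chir → ℂ :=
  ![if x.2 = 0 then
      (if x.1 < 0 then C (0, 0) 0 0 * z ^ x.1 else if x.1 < m then z ^ x.1 else 0)
    else if x.2 = n then (if x.1 < 0 then C (0, n) 0 3 * a2 * z ^ x.1 else 0) else 0,
    if x.2 = 0 then (if m < x.1 then C (m, 0) 1 2 * a4 * z ^ (m - x.1) else 0)
    else if x.2 = n then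
      (if m < x.1 then C (m, n) 1 1 * a3 * z ^ (m - x.1)
        else if 0 < x.1 then C (0, n) 1 3 * a2 * z ^ (- x.1) else 0) else 0,
    if x.1 = 0 then (if x.2 < 0 then C (0, 0) 2 0 * z ^ x.2 else 0)
    else if x.1 = m then
      (if x.2 < 0 then C (m, 0) 2 2 * a4 * z ^ x.2
        else if x.2 < n then C (m, n) 2 1 * a3 * z ^ (x.2 - n) else 0) else 0,
    if x.1 = 0 then
      (if n < x.2 then C (0, n) 3 3 * a2 * z ^ (n - x.2)
        else if 0 < x.2 then C (0, 0) 3 0 * z ^ (- x.2) else 0)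
    else if x.1 = m then (if n < x.2 then C (m, n) 3 1 * a3 * z ^ (n - x.2) else 0) else 0]

theorem ptCoin_off (C : Site → Matrix Chir Chir ℂ) (u : Site → Chir → ℂ) (x : Site) (i : Chir)
    (h : C x = 1) : ptCoin C u x i = u x i := by
  simp [ptCoin, h, Matrix.one_apply]

theorem not_corner {m n : ℤ} {x : Site} (h1 : ¬ (x.1 = 0 ∧ x.2 = 0)) (h2 : ¬ (x.1 = m ∧ x.2 = 0))
    (h3 : ¬ (x.1 = m ∧ x.2 = n)) (h4 : ¬ (x.1 = 0 ∧ x.2 = n)) : x ∉ corners m n := by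
  simp only [corners, Set.mem_insert_iff, Set.mem_singleton_iff, Prod.ext_iff]
  tauto

theorem corner_cases (m n : ℤ) (x : Site) : x = (0, 0) ∨ x = (m, 0) ∨ x = (m, n) ∨ x = (0, n) ∨
    (x ∉ corners m n ∧ ¬ (x.1 = 0 ∧ x.2 = 0) ∧ ¬ (x.1 = m ∧ x.2 = 0) ∧
      ¬ (x.1 = m ∧ x.2 = n) ∧ ¬ (x.1 = 0 ∧ x.2 = n)) := by
  simp only [corners, Set.mem_insert_iff, Set.mem_singleton_iff, Prod.ext_iff]
  tauto

section
variable {m n : ℤ} (hm : 1 ≤ m) (hn : 1 ≤ n) {C : Site → Matrix Chir Chir ℂ} {z a2 a3 a4 : ℂ}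

theorem sol_00 (hm : 1 ≤ m) (hn : 1 ≤ n) : sol m n C z a2 a3 a4 (0, 0) = ![1, 0, 0, 0] := by
  have h1 : (0:ℤ) < m := by omega
  have h2 : ¬ (m < 0) := by omega
  have h3 : ¬ (n < 0) := by omega
  simp [sol, h1, h2, h3]

theorem sol_0n (hm : 1 ≤ m) (hn : 1 ≤ n) (h : a2 = C (0, 0) 3 0 * z ^ (-n)) :
    sol m n C z a2 a3 a4 (0, n) = ![0, 0, 0, a2] := by
  have h1 : (0:ℤ) < n := by omega
  have h2 : ¬ (m < 0) := by omega
  have h3 : ¬ (n < 0) := by omega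
  have h4 : n ≠ 0 := by omega
  have h5 : m ≠ 0 := by omega
  simp [sol, h1, h2, h3, h4, h]

theorem sol_mn (hm : 1 ≤ m) (hn : 1 ≤ n) (h : a3 = C (0, n) 1 3 * a2 * z ^ (-m)) :
    sol m n C z a2 a3 a4 (m, n) = ![0, a3, 0, 0] := by
  have h1 : (0:ℤ) < m := by omega
  have h2 : ¬ (m < 0) := by omega
  have h3 : ¬ (n < 0) := by omega
  have h4 : n ≠ 0 := by omega
  have h5 : m ≠ 0 := by omega
  simp [sol, h1, h2, h3, h4, h5, h]

theorem sol_m0 (hm : 1 ≤ m) (hn : 1 ≤ n) (h : a4 = C (m, n) 2 1 * a3 * z ^ (-n)) :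
    sol m n C z a2 a3 a4 (m, 0) = ![0, 0, a4, 0] := by
  have h1 : (0:ℤ) < n := by omega
  have h2 : ¬ (m < 0) := by omega
  have h3 : ¬ (n < 0) := by omega
  have h4 : n ≠ 0 := by omega
  have h5 : m ≠ 0 := by omega
  simp [sol, h1, h2, h3, h5, h]

theorem ptCoin_expand (C : Site → Matrix Chir Chir ℂ) (u : Site → Chir → ℂ) (x : Site) (i : Chir) :
    ptCoin C u x i = C x i 0 * u x 0 + C x i 1 * u x 1 + C x i 2 * u x 2 + C x i 3 * u x 3 := by
  simp [ptCoin, Fin.sum_univ_four]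

set_option linter.unusedSimpArgs false in
theorem sol_step (hm : 1 ≤ m) (hn : 1 ≤ n) (hz : z ≠ 0)
    (hoff : ∀ x, x ∉ corners m n → C x = 1)
    (z1 : C (0, 0) 1 0 = 0) (z2 : C (m, 0) 3 2 = 0) (z3 : C (m, n) 0 1 = 0) (z4 : C (0, n) 2 3 = 0)
    (h2 : a2 = C (0, 0) 3 0 * z ^ (-n)) (h3 : a3 = C (0, n) 1 3 * a2 * z ^ (-m))
    (h4 : a4 = C (m, n) 2 1 * a3 * z ^ (-n)) (h1 : C (m, 0) 0 2 * a4 = z ^ m) (x : Site) :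
    ptCoin C (sol m n C z a2 a3 a4) x 0 = z * sol m n C z a2 a3 a4 (x.1 - 1, x.2) 0 ∧
    ptCoin C (sol m n C z a2 a3 a4) x 1 = z * sol m n C z a2 a3 a4 (x.1 + 1, x.2) 1 ∧
    ptCoin C (sol m n C z a2 a3 a4) x 2 = z * sol m n C z a2 a3 a4 (x.1, x.2 - 1) 2 ∧
    ptCoin C (sol m n C z a2 a3 a4) x 3 = z * sol m n C z a2 a3 a4 (x.1, x.2 + 1) 3 := by
  have k1 : (0:ℤ) < n := by omega
  have k2 : ¬ (m < 0) := by omega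
  have k3 : ¬ (n < 0) := by omega
  have k4 : n ≠ 0 := by omega
  have k5 : m ≠ 0 := by omega
  have k6 : (0:ℤ) < m := by omega
  have k7 : ¬ (m + 1 = 0) := by omega
  have k8 : ¬ (n + 1 = 0) := by omega
  have k9 : ¬ (m - 1 < 0) := by omega
  have k10 : ¬ (n - 1 < 0) := by omega
  have k11 : 0 ≤ m := by omega
  have k12 : 0 ≤ n := by omega
  have k13 : ¬ (m < 1) := by omega
  have k14 : ¬ (n < 1) := by omega
  have e1 : ∀ k : ℤ, z * z ^ (k - 1) = z ^ k := fun k => by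
    rw [zpow_sub_one₀ hz]; field_simp
  have e2 : ∀ k j : ℤ, z * z ^ (k - (j + 1)) = z ^ (k - j) := fun k j => by
    rw [← e1 (k - j)]; congr 2; ring
  have e3 : ∀ j : ℤ, z * z ^ (-(j + 1)) = z ^ (-j) := fun j => by
    rw [← e1 (- j)]; congr 2; ring
  have e4 : ∀ k j : ℤ, z * z ^ (k - 1 - j) = z ^ (k - j) := fun k j => by
    rw [← e1 (k - j)]; congr 2; ring
  have e5 : ∀ w : ℂ, z * (w * z⁻¹) = w := fun w => by field_simp
  have s1 := sol_00 (C := C) (z := z) (a2 := a2) (a3 := a3) (a4 := a4) hm hn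
  have s2 := sol_0n (C := C) (z := z) (a2 := a2) (a3 := a3) (a4 := a4) hm hn h2
  have s3 := sol_mn (C := C) (z := z) (a2 := a2) (a3 := a3) (a4 := a4) hm hn h3
  have s4 := sol_m0 (C := C) (z := z) (a2 := a2) (a3 := a3) (a4 := a4) hm hn h4
  rcases corner_cases m n x with rfl | rfl | rfl | rfl | ⟨hx, c1, c2, c3, c4⟩
  · simp only [ptCoin_expand, s1]
    simp [sol, k1, k2, k3, k4, k5, k6, k7, k8, k9, k10, k11, k12, k13, k14, e1, e5, h1, z1, z2, z3, z4]
  · simp only [ptCoin_expand, s4]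
    simp [sol, k1, k2, k3, k4, k5, k6, k7, k8, k9, k10, k11, k12, k13, k14, e1, e5, h1, z1, z2, z3, z4]
  · simp only [ptCoin_expand, s3]
    simp [sol, k1, k2, k3, k4, k5, k6, k7, k8, k9, k10, k11, k12, k13, k14, e1, e5, h1, z1, z2, z3, z4]
  · simp only [ptCoin_expand, s2]
    simp [sol, k1, k2, k3, k4, k5, k6, k7, k8, k9, k10, k11, k12, k13, k14, e1, e5, h1, z1, z2, z3, z4]
  · simp only [ptCoin_off _ _ _ _ (hoff x hx)]
    obtain ⟨x1, x2⟩ := x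
    simp only at c1 c2 c3 c4
    clear s1 s2 s3 s4 hoff hx h1 h2 h3 h4
    refine ⟨?_, ?_, ?_, ?_⟩
    · simp only [sol, Matrix.cons_val_zero]
      have := e1 x1
      split_ifs <;> first | omega | exact (e1 _).symm | (rw [← this]; ring) | simp
    · simp only [sol, Matrix.cons_val_one, Matrix.cons_val_zero]
      have := e2 m x1
      have := e3 x1
      split_ifs <;> first | omega | exact (e1 _).symm | (rw [← e2 m x1]; ring) | (rw [← e3 x1]; ring) | simp
    · simp only [sol, Matrix.cons_val]
      split_ifs <;> first | omega | exact (e1 _).symm | (rw [← e1 x2]; ring) | (rw [← e4 x2]; ring) | simp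
    · simp only [sol, Matrix.cons_val]
      split_ifs <;> first | omega | exact (e1 _).symm | (rw [← e2 n x2]; ring) | (rw [← e3 x2]; ring) | simp


theorem sol_pt (hm : 1 ≤ m) (hn : 1 ≤ n) (hz : z ≠ 0)
    (hoff : ∀ x, x ∉ corners m n → C x = 1)
    (z1 : C (0, 0) 1 0 = 0) (z2 : C (m, 0) 3 2 = 0) (z3 : C (m, n) 0 1 = 0) (z4 : C (0, n) 2 3 = 0)
    (h2 : a2 = C (0, 0) 3 0 * z ^ (-n)) (h3 : a3 = C (0, n) 1 3 * a2 * z ^ (-m))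
    (h4 : a4 = C (m, n) 2 1 * a3 * z ^ (-n)) (h1 : C (m, 0) 0 2 * a4 = z ^ m)
    (x : Site) (i : Chir) :
    ptWalk C (sol m n C z a2 a3 a4) x i = z * sol m n C z a2 a3 a4 x i := by
  have h := sol_step hm hn hz hoff z1 z2 z3 z4 h2 h3 h4 h1
  obtain ⟨x1, x2⟩ := x
  fin_cases i
  · simpa [ptWalk, ptShift] using (h (x1 + 1, x2)).1
  · simpa [ptWalk, ptShift] using (h (x1 - 1, x2)).2.1
  · simpa [ptWalk, ptShift] using (h (x1, x2 + 1)).2.2.1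
  · simpa [ptWalk, ptShift] using (h (x1, x2 - 1)).2.2.2

theorem mem_im0 (x : Site) : (x, (0 : Chir)) ∈ imPhiPlus m n ↔ x.2 = 0 ∧ 0 ≤ x.1 ∧ x.1 < m := by
  obtain ⟨x1, x2⟩ := x
  simp only [imPhiPlus, Set.mem_union, Set.mem_ofPred_eq, Prod.mk.injEq]
  constructor
  · rintro (((⟨t, _, _, _, h⟩ | ⟨t, _, _, _, h⟩) | ⟨t, _, _, _, h⟩) | ⟨t, _, _, ⟨_, _⟩, _⟩)
    · simp at h
    · simp at h
    · simp at h
    · omega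
  · rintro ⟨h1, h2, h3⟩
    exact Or.inr ⟨x1, by omega, by omega, ⟨rfl, h1⟩, trivial⟩

theorem mem_im1 (x : Site) : (x, (1 : Chir)) ∈ imPhiPlus m n ↔ x.2 = n ∧ 0 < x.1 ∧ x.1 ≤ m := by
  obtain ⟨x1, x2⟩ := x
  simp only [imPhiPlus, Set.mem_union, Set.mem_ofPred_eq, Prod.mk.injEq]
  constructor
  · rintro (((⟨t, _, _, _, h⟩ | ⟨t, _, _, ⟨_, _⟩, h⟩) | ⟨t, _, _, _, h⟩) | ⟨t, _, _, _, h⟩)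
    · simp at h
    · omega
    · simp at h
    · simp at h
  · rintro ⟨h1, h2, h3⟩
    exact Or.inl (Or.inl (Or.inr ⟨x1, by omega, by omega, ⟨rfl, h1⟩, trivial⟩))

theorem mem_im2 (x : Site) : (x, (2 : Chir)) ∈ imPhiPlus m n ↔ x.1 = m ∧ 0 ≤ x.2 ∧ x.2 < n := by
  obtain ⟨x1, x2⟩ := x
  simp only [imPhiPlus, Set.mem_union, Set.mem_ofPred_eq, Prod.mk.injEq]
  constructor
  · rintro (((⟨t, _, _, _, h⟩ | ⟨t, _, _, _, h⟩) | ⟨t, _, _, ⟨_, _⟩, h⟩) | ⟨t, _, _, _, h⟩)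
    · simp at h
    · simp at h
    · omega
    · simp at h
  · rintro ⟨h1, h2, h3⟩
    exact Or.inl (Or.inr ⟨x2, by omega, by omega, ⟨h1, rfl⟩, trivial⟩)

theorem mem_im3 (x : Site) : (x, (3 : Chir)) ∈ imPhiPlus m n ↔ x.1 = 0 ∧ 0 < x.2 ∧ x.2 ≤ n := by
  obtain ⟨x1, x2⟩ := x
  simp only [imPhiPlus, Set.mem_union, Set.mem_ofPred_eq, Prod.mk.injEq]
  constructor
  · rintro (((⟨t, _, _, ⟨_, _⟩, h⟩ | ⟨t, _, _, _, h⟩) | ⟨t, _, _, _, h⟩) | ⟨t, _, _, _, h⟩)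
    · omega
    · simp at h
    · simp at h
    · simp at h
  · rintro ⟨h1, h2, h3⟩
    exact Or.inl (Or.inl (Or.inl ⟨x2, by omega, by omega, ⟨h1, rfl⟩, trivial⟩))

theorem mem_tail0 (x1 x2 : ℤ) (h : x1 < 0) (h' : x2 = 0 ∨ x2 = n) :
    ((x1, x2), (0 : Chir)) ∈ tails m n :=
  Or.inl (Or.inl (Or.inl ⟨-x1, x2, by omega, h', by simp⟩))

theorem mem_tail3 (x1 x2 : ℤ) (h : n < x2) (h' : x1 = 0 ∨ x1 = m) :
    ((x1, x2), (3 : Chir)) ∈ tails m n :=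
  Or.inl (Or.inl (Or.inr ⟨x2 - n, x1, by omega, h', by simp⟩))

theorem mem_tail2 (x1 x2 : ℤ) (h : x2 < 0) (h' : x1 = 0 ∨ x1 = m) :
    ((x1, x2), (2 : Chir)) ∈ tails m n :=
  Or.inl (Or.inr ⟨-x2, x1, by omega, h', by simp⟩)

theorem mem_tail1 (x1 x2 : ℤ) (h : m < x1) (h' : x2 = 0 ∨ x2 = n) :
    ((x1, x2), (1 : Chir)) ∈ tails m n :=
  Or.inr ⟨x1 - m, x2, by omega, h', by simp⟩

theorem sol_supp (x : Site) (i : Chir)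
    (h : (x, i) ∉ imPhiPlus m n ∪ tails m n) : sol m n C z a2 a3 a4 x i = 0 := by
  rw [Set.mem_union, not_or] at h
  obtain ⟨hi, ht⟩ := h
  obtain ⟨x1, x2⟩ := x
  fin_cases i
  · have hi' := mt (mem_im0 (x1, x2)).2 hi
    have ht' : ¬ (x1 < 0 ∧ (x2 = 0 ∨ x2 = n)) := fun h => ht (mem_tail0 x1 x2 h.1 h.2)
    simp only at hi'
    simp only [sol, Fin.zero_eta, Matrix.cons_val]
    split_ifs <;> first | rfl | (exfalso; omega)
  · have hi' := mt (mem_im1 (x1, x2)).2 hi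
    have ht' : ¬ (m < x1 ∧ (x2 = 0 ∨ x2 = n)) := fun h => ht (mem_tail1 x1 x2 h.1 h.2)
    simp only at hi'
    simp only [sol, Fin.mk_one, Matrix.cons_val]
    split_ifs <;> first | rfl | (exfalso; omega)
  · have hi' := mt (mem_im2 (x1, x2)).2 hi
    have ht' : ¬ (x2 < 0 ∧ (x1 = 0 ∨ x1 = m)) := fun h => ht (mem_tail2 x1 x2 h.1 h.2)
    simp only at hi'
    simp only [sol, Fin.reduceFinMk, Matrix.cons_val]
    split_ifs <;> first | rfl | (exfalso; omega)
  · have hi' := mt (mem_im3 (x1, x2)).2 hi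
    have ht' : ¬ (n < x2 ∧ (x1 = 0 ∨ x1 = m)) := fun h => ht (mem_tail3 x1 x2 h.1 h.2)
    simp only at hi'
    simp only [sol, Fin.reduceFinMk, Matrix.cons_val]
    split_ifs <;> first | rfl | (exfalso; omega)

theorem sol_supp' (t1 : C (0, 0) 0 0 = 0) (t2 : C (0, 0) 2 0 = 0) (t3 : C (0, n) 0 3 = 0)
    (t4 : C (0, n) 3 3 = 0) (t5 : C (m, n) 1 1 = 0) (t6 : C (m, n) 3 1 = 0)
    (t7 : C (m, 0) 1 2 = 0) (t8 : C (m, 0) 2 2 = 0) (x : Site) (i : Chir)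
    (hi : (x, i) ∉ imPhiPlus m n) : sol m n C z a2 a3 a4 x i = 0 := by
  obtain ⟨x1, x2⟩ := x
  fin_cases i
  · have hi' := mt (mem_im0 (x1, x2)).2 hi
    simp only at hi'
    simp only [sol, Fin.zero_eta, Matrix.cons_val, t1, t2, t3, t4, t5, t6, t7, t8, zero_mul]
    split_ifs <;> first | rfl | (exfalso; omega)
  · have hi' := mt (mem_im1 (x1, x2)).2 hi
    simp only at hi'
    simp only [sol, Fin.mk_one, Matrix.cons_val, t1, t2, t3, t4, t5, t6, t7, t8, zero_mul]
    split_ifs <;> first | rfl | (exfalso; omega)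
  · have hi' := mt (mem_im2 (x1, x2)).2 hi
    simp only at hi'
    simp only [sol, Fin.reduceFinMk, Matrix.cons_val, t1, t2, t3, t4, t5, t6, t7, t8, zero_mul]
    split_ifs <;> first | rfl | (exfalso; omega)
  · have hi' := mt (mem_im3 (x1, x2)).2 hi
    simp only at hi'
    simp only [sol, Fin.reduceFinMk, Matrix.cons_val, t1, t2, t3, t4, t5, t6, t7, t8, zero_mul]
    split_ifs <;> first | rfl | (exfalso; omega)

theorem sol_out (hm : 1 ≤ m) (hn : 1 ≤ n) (κ : ℂ) (hz : z = Complex.exp (-(Complex.I * κ))) :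
    IsOutgoing (max m n) κ (sol m n C z a2 a3 a4) := by
  have hz0 : z ≠ 0 := by rw [hz]; exact Complex.exp_ne_zero _
  have p1 : ∀ k : ℤ, Complex.exp (-(Complex.I * κ * k)) = z ^ k := fun k => by
    rw [hz, ← Complex.exp_int_mul]; congr 1; ring
  have p2 : ∀ k : ℤ, Complex.exp (Complex.I * κ * k) = z ^ (-k) := fun k => by
    rw [← p1]; congr 1; push_cast; ring
  have p3 : ∀ k j : ℤ, z ^ (k - j) = z ^ k * z ^ (-j) := fun k j => by
    rw [← zpow_add₀ hz0]; congr 1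
  refine ⟨fun y => if y = 0 then C (0, 0) 0 0 else if y = n then C (0, n) 0 3 * a2 else 0,
    fun y => if y = 0 then C (m, 0) 1 2 * a4 * z ^ m
      else if y = n then C (m, n) 1 1 * a3 * z ^ m else 0,
    fun y => if y = 0 then C (0, 0) 2 0 else if y = m then C (m, 0) 2 2 * a4 else 0,
    fun y => if y = 0 then C (0, n) 3 3 * a2 * z ^ n
      else if y = m then C (m, n) 3 1 * a3 * z ^ n else 0, ?_, ?_, ?_, ?_, ?_, ?_, ?_, ?_⟩ <;>
    rintro ⟨x1, x2⟩ hx <;>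
    simp only [p1, p2, sol, Matrix.cons_val, p3 m x1, p3 n x2] <;>
    simp only at hx <;>
    split_ifs <;> first | omega | rfl | ring

theorem leg (f : ℤ → ℂ) (b : ℤ) (c : ℂ) (h0 : c = z * f 1)
    (h : ∀ t, 1 ≤ t → t < b → f t = z * f (t + 1)) (hz : z ≠ 0) :
    ∀ t, 1 ≤ t → t ≤ b → c = z ^ t * f t := by
  intro t ht
  induction t, ht using Int.leInduction with
  | base => intro _; simpa using h0
  | succ k hk ih =>
    intro hb
    rw [ih (by omega), h k hk (by omega), zpow_add_one₀ hz]
    ring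

theorem fwd (hm : 1 ≤ m) (hn : 1 ≤ n) (hz : z ≠ 0)
    (hoff : ∀ x, x ∉ corners m n → C x = 1) (u : Site → Chir → ℂ)
    (hU : ∀ x i, ptWalk C u x i = z * u x i)
    (hs : ∀ x i, (x, i) ∉ imPhiPlus m n → u x i = 0) (hu : ∃ x i, u x i ≠ 0) :
    z ^ (2 * (m + n)) = cPlus m n C := by
  have g0 : ∀ x1 x2 : ℤ, ptCoin C u (x1, x2) 0 = z * u (x1 - 1, x2) 0 := fun x1 x2 => by
    simpa [ptWalk, ptShift] using hU (x1 - 1, x2) 0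
  have g1 : ∀ x1 x2 : ℤ, ptCoin C u (x1, x2) 1 = z * u (x1 + 1, x2) 1 := fun x1 x2 => by
    simpa [ptWalk, ptShift] using hU (x1 + 1, x2) 1
  have g2 : ∀ x1 x2 : ℤ, ptCoin C u (x1, x2) 2 = z * u (x1, x2 - 1) 2 := fun x1 x2 => by
    simpa [ptWalk, ptShift] using hU (x1, x2 - 1) 2
  have g3 : ∀ x1 x2 : ℤ, ptCoin C u (x1, x2) 3 = z * u (x1, x2 + 1) 3 := fun x1 x2 => by
    simpa [ptWalk, ptShift] using hU (x1, x2 + 1) 3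
  have s0 : ∀ x1 x2 : ℤ, ¬ (x2 = 0 ∧ 0 ≤ x1 ∧ x1 < m) → u (x1, x2) 0 = 0 := fun x1 x2 h =>
    hs _ _ (fun h' => h ((mem_im0 (x1, x2)).1 h'))
  have s1 : ∀ x1 x2 : ℤ, ¬ (x2 = n ∧ 0 < x1 ∧ x1 ≤ m) → u (x1, x2) 1 = 0 := fun x1 x2 h =>
    hs _ _ (fun h' => h ((mem_im1 (x1, x2)).1 h'))
  have s2 : ∀ x1 x2 : ℤ, ¬ (x1 = m ∧ 0 ≤ x2 ∧ x2 < n) → u (x1, x2) 2 = 0 := fun x1 x2 h =>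
    hs _ _ (fun h' => h ((mem_im2 (x1, x2)).1 h'))
  have s3 : ∀ x1 x2 : ℤ, ¬ (x1 = 0 ∧ 0 < x2 ∧ x2 ≤ n) → u (x1, x2) 3 = 0 := fun x1 x2 h =>
    hs _ _ (fun h' => h ((mem_im3 (x1, x2)).1 h'))
  have off : ∀ (x1 x2 : ℤ) (i : Chir), ¬ (x1 = 0 ∧ x2 = 0) → ¬ (x1 = m ∧ x2 = 0) →
      ¬ (x1 = m ∧ x2 = n) → ¬ (x1 = 0 ∧ x2 = n) → ptCoin C u (x1, x2) i = u (x1, x2) i :=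
    fun x1 x2 i h1 h2 h3 h4 => ptCoin_off _ _ _ _ (hoff _ (not_corner h1 h2 h3 h4))
  have q1 := leg (z := z) (fun t => u (0, t) 3) n (C (0, 0) 3 0 * u (0, 0) 0) (by
      have := g3 0 0
      rw [ptCoin_expand, s1 0 0 (by omega), s2 0 0 (by omega), s3 0 0 (by omega)] at this
      simpa using this) (by
      intro t h1 h2
      rw [← g3, off] <;> omega) hz
  have q2 := leg (z := z) (fun t => u (t, n) 1) m (C (0, n) 1 3 * u (0, n) 3) (by
      have := g1 0 n
      rw [ptCoin_expand, s0 0 n (by omega), s1 0 n (by omega), s2 0 n (by omega)] at this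
      simpa using this) (by
      intro t h1 h2
      rw [← g1, off] <;> omega) hz
  have q3 := leg (z := z) (fun t => u (m, n - t) 2) n (C (m, n) 2 1 * u (m, n) 1) (by
      have := g2 m n
      rw [ptCoin_expand, s0 m n (by omega), s2 m n (by omega), s3 m n (by omega)] at this
      simpa using this) (by
      intro t h1 h2
      rw [show n - (t + 1) = n - t - 1 by ring, ← g2, off] <;> omega) hz
  have q4 := leg (z := z) (fun t => u (m - t, 0) 0) m (C (m, 0) 0 2 * u (m, 0) 2) (by
      have := g0 m 0
      rw [ptCoin_expand, s0 m 0 (by omega), s1 m 0 (by omega), s3 m 0 (by omega)] at this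
      simpa using this) (by
      intro t h1 h2
      rw [show m - (t + 1) = m - t - 1 by ring, ← g0, off] <;> omega) hz
  have r1 := q1 n hn le_rfl
  have r2 := q2 m hm le_rfl
  have r3 := q3 n hn le_rfl
  have r4 := q4 m hm le_rfl
  simp only [sub_self] at r1 r2 r3 r4
  have hzk : ∀ k : ℤ, z ^ k ≠ 0 := fun k => zpow_ne_zero k hz
  have hp : u (0, 0) 0 ≠ 0 := by
    intro h
    have t1 : ∀ t, 1 ≤ t → t ≤ n → u (0, t) 3 = 0 := fun t h1 h2 => by
      have := q1 t h1 h2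
      simpa [h, hzk] using this.symm
    have t2 : ∀ t, 1 ≤ t → t ≤ m → u (t, n) 1 = 0 := fun t h1 h2 => by
      have := q2 t h1 h2
      simpa [t1 n hn le_rfl, hzk] using this.symm
    have t3 : ∀ t, 1 ≤ t → t ≤ n → u (m, n - t) 2 = 0 := fun t h1 h2 => by
      have := q3 t h1 h2
      simpa [t2 m hm le_rfl, hzk] using this.symm
    have t30 : u (m, 0) 2 = 0 := by simpa using t3 n hn le_rfl
    have t4 : ∀ t, 1 ≤ t → t ≤ m → u (m - t, 0) 0 = 0 := fun t h1 h2 => by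
      have := q4 t h1 h2
      simpa [t30, hzk] using this.symm
    obtain ⟨⟨x1, x2⟩, i, hx⟩ := hu
    apply hx
    fin_cases i
    · by_cases hc : x2 = 0 ∧ 0 ≤ x1 ∧ x1 < m
      · have := t4 (m - x1) (by omega) (by omega)
        rw [sub_sub_cancel, ← hc.1] at this
        exact this
      · exact s0 _ _ hc
    · by_cases hc : x2 = n ∧ 0 < x1 ∧ x1 ≤ m
      · rw [hc.1]; exact t2 x1 (by omega) (by omega)
      · exact s1 _ _ hc
    · by_cases hc : x1 = m ∧ 0 ≤ x2 ∧ x2 < n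
      · have := t3 (n - x2) (by omega) (by omega)
        rw [sub_sub_cancel, ← hc.1] at this
        exact this
      · exact s2 _ _ hc
    · by_cases hc : x1 = 0 ∧ 0 < x2 ∧ x2 ≤ n
      · rw [hc.1]; exact t1 x2 (by omega) (by omega)
      · exact s3 _ _ hc
  have e : z ^ (2 * (m + n)) = z ^ n * z ^ m * z ^ n * z ^ m := by
    rw [← zpow_add₀ hz, ← zpow_add₀ hz, ← zpow_add₀ hz]; congr 1; ring
  apply mul_right_cancel₀ hp
  rw [e, cPlus]
  linear_combination (-(z ^ n * z ^ m * z ^ n)) * r4 - (z ^ n * z ^ m * C (m, 0) 0 2) * r3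
    - (z ^ n * C (m, 0) 0 2 * C (m, n) 2 1) * r2
    - (C (m, 0) 0 2 * C (m, n) 2 1 * C (0, n) 1 3) * r1

theorem col_zero (M : Matrix Chir Chir ℂ) (hM : M ∈ Matrix.unitaryGroup Chir ℂ) (i j k : Chir)
    (h : ‖M i j‖ = 1) (hk : k ≠ i) : M k j = 0 := by
  have h1 := congrFun (congrFun (Matrix.mem_unitaryGroup_iff'.1 hM) j) j
  rw [Matrix.mul_apply] at h1
  have h2 : ∑ l, ‖M l j‖ ^ 2 = 1 := by
    have : ((∑ l, ‖M l j‖ ^ 2 : ℝ) : ℂ) = 1 := by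
      push_cast
      simp only [Matrix.star_apply, Matrix.one_apply_eq] at h1
      rw [← h1]
      refine Finset.sum_congr rfl fun l _ => ?_
      rw [← Complex.conj_mul']; rfl
    exact_mod_cast this
  rw [← Finset.add_sum_erase _ _ (Finset.mem_univ i), h] at h2
  have h3 : ∑ l ∈ Finset.univ.erase i, ‖M l j‖ ^ 2 = 0 := by linarith
  have h4 := (Finset.sum_eq_zero_iff_of_nonneg (fun l _ => by positivity)).1 h3 k (by simp [hk])
  simpa using h4

theorem norms_one (a b c d : ℝ) (ha : 0 ≤ a) (hb : 0 ≤ b) (hc : 0 ≤ c) (hd : 0 ≤ d)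
    (ha' : a ≤ 1) (hb' : b ≤ 1) (hc' : c ≤ 1) (hd' : d ≤ 1) (h : a * b * c * d = 1) :
    a = 1 ∧ b = 1 ∧ c = 1 ∧ d = 1 := by
  have x1 : a * b ≤ 1 := mul_le_one₀ ha' hb hb'
  have x2 : a * b * c ≤ 1 := mul_le_one₀ x1 hc hc'
  have x0 : 0 ≤ a * b := by positivity
  have x00 : 0 ≤ a * b * c := by positivity
  have y1 : d = 1 := by nlinarith
  have y2 : c = 1 := by subst y1; nlinarith
  have y3 : b = 1 := by subst y1 y2; nlinarith
  have y4 : a = 1 := by subst y1 y2 y3; nlinarith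
  exact ⟨y4, y3, y2, y1⟩

end

theorem im_finite {m n : ℤ} (hm : 1 ≤ m) (hn : 1 ≤ n) : (imPhiPlus m n).Finite := by
  have : imPhiPlus m n ⊆
      ((Set.Icc 0 m ×ˢ Set.Icc 0 n) ×ˢ (Set.univ : Set Chir) : Set (Site × Chir)) := by
    rintro ⟨⟨x1, x2⟩, i⟩ h
    simp only [imPhiPlus, Set.mem_union, Set.mem_ofPred_eq, Prod.mk.injEq] at h
    simp only [Set.mem_prod, Set.mem_Icc, Set.mem_univ, and_true]
    rcases h with ((⟨t, _, _, ⟨_, _⟩, h⟩ | ⟨t, _, _, ⟨_, _⟩, h⟩) | ⟨t, _, _, ⟨_, _⟩, h⟩) |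
      ⟨t, _, _, ⟨_, _⟩, h⟩ <;> omega
  exact (((Set.finite_Icc _ _).prod (Set.finite_Icc _ _)).prod Set.finite_univ).subset this

theorem exists_lift {m n : ℤ} (hm : 1 ≤ m) (hn : 1 ≤ n) (v : Site → Chir → ℂ)
    (hs : ∀ x i, (x, i) ∉ imPhiPlus m n → v x i = 0) : ∃ u : H, ∀ x i, u x i = v x i := by
  have : Memℓp (fun x : Site => (WithLp.toLp 2 (v x) : V)) 2 := by
    refine Memℓp.of_exponent_ge (memℓp_zero ?_) zero_le
    refine ((im_finite hm hn).image Prod.fst).subset ?_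
    intro x hx
    by_contra hc
    apply hx
    ext i
    exact hs x i (fun h => hc ⟨_, h, rfl⟩)
  exact ⟨⟨_, this⟩, fun x i => rfl⟩

theorem op_apply {C : Site → Matrix Chir Chir ℂ} {S Cop : H →L[ℂ] H} (hS : IsShiftOp S)
    (hCop : IsCoinOp Cop C) (u : H) (x : Site) (i : Chir) :
    (S.comp Cop) u x i = ptWalk C (fun x i => u x i) x i := by
  have h := hS (Cop u) x
  have h' := hCop u
  fin_cases i
  · exact h.1.trans (h' _ _)
  · exact h.2.1.trans (h' _ _)
  · exact h.2.2.1.trans (h' _ _)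
  · exact h.2.2.2.trans (h' _ _)

theorem ncard_roots (c : ℂ) (hc : c ≠ 0) (N : ℕ) (hN : 0 < N) :
    Set.ncard {z : ℂ | z ^ N = c} = N := by
  classical
  have hp := Complex.isPrimitiveRoot_exp N hN.ne'
  have hex : ∃ a : ℂ, a ^ N = c := IsAlgClosed.exists_pow_nat_eq c hN
  have : {z : ℂ | z ^ N = c} = ((Polynomial.nthRoots N c).toFinset : Set ℂ) := by
    ext z; simp [Polynomial.mem_nthRoots hN]
  rw [this, Set.ncard_coe_finset, Multiset.toFinset_card_of_nodup (hp.nthRoots_nodup hc),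
    hp.card_nthRoots, if_pos hex]

theorem exp_eq (m n : ℤ) (κ : ℂ) :
    Complex.exp (-(2 * ((m : ℂ) + (n : ℂ)) * Complex.I * κ)) =
      Complex.exp (-(Complex.I * κ)) ^ (2 * (m + n)) := by
  rw [← Complex.exp_int_mul]; congr 1; push_cast; ring

theorem exists_real (z : ℂ) (h : ‖z‖ = 1) : ∃ κ : ℝ, z = Complex.exp (-(Complex.I * (κ : ℂ))) := by
  refine ⟨-z.arg, ?_⟩
  have := Complex.norm_mul_exp_arg_mul_I z
  rw [h] at this
  nth_rewrite 1 [← this]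
  push_cast
  simp [mul_comm]

/-- quantization condition along `Φ₊` for eigenvalues and resonant states of a
perturbed four-corner quantum walk. -/
theorem fourCorner_perturbed_quantization
    (m₀ n₀ : ℤ) (hm : 1 ≤ m₀) (hn : 1 ≤ n₀)
    (ε : ℝ) (hε0 : 0 < ε) (hε1 : ε ≤ 1)
    (Cε : Site → Matrix Chir Chir ℂ) (hCε : IsPerturbedFourCorner m₀ n₀ ε Cε)
    (S Cop : H →L[ℂ] H) (hS : IsShiftOp S) (hCop : IsCoinOp Cop Cε)
    (hUnit : S.comp Cop ∈ unitary (H →L[ℂ] H)) :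
    ((∃ (z : ℂ) (u : H), u ≠ 0 ∧ (S.comp Cop) u = z • u ∧
        SupportedOn u (imPhiPlus m₀ n₀)) ↔ ‖cPlus m₀ n₀ Cε‖ = 1) ∧
    (‖cPlus m₀ n₀ Cε‖ = 1 →
      (∀ z : ℂ,
        (∃ u : H, u ≠ 0 ∧ (S.comp Cop) u = z • u ∧ SupportedOn u (imPhiPlus m₀ n₀)) ↔
        (∃ κ : ℝ, z = Complex.exp (-(Complex.I * (κ : ℂ))) ∧
          Complex.exp (-(2 * ((m₀ : ℂ) + (n₀ : ℂ)) * Complex.I * (κ : ℂ)))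
            = cPlus m₀ n₀ Cε)) ∧
      Set.ncard {z : ℂ | ∃ κ : ℝ, z = Complex.exp (-(Complex.I * (κ : ℂ))) ∧
          Complex.exp (-(2 * ((m₀ : ℂ) + (n₀ : ℂ)) * Complex.I * (κ : ℂ)))
            = cPlus m₀ n₀ Cε} = (2 * (m₀ + n₀)).toNat) ∧
    (‖cPlus m₀ n₀ Cε‖ < 1 →
      ∀ κ : ℂ, κ.im < 0 →
        Complex.exp (-(2 * ((m₀ : ℂ) + (n₀ : ℂ)) * Complex.I * κ)) = cPlus m₀ n₀ Cε →
        ∃ u : Site → Chir → ℂ, u ≠ 0 ∧ IsOutgoing (max m₀ n₀) κ u ∧ IsPtSolution Cε κ u ∧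
          ∀ (x : Site) (i : Chir), (x, i) ∉ imPhiPlus m₀ n₀ ∪ tails m₀ n₀ → u x i = 0) := by
  obtain ⟨hun, hoff, -, z1, -, z2, -, -, z3, -, z4⟩ := hCε
  have cexpand : ∀ z : ℂ, z ≠ 0 → z ^ (2 * (m₀ + n₀)) = cPlus m₀ n₀ Cε →
      Cε (m₀, 0) 0 2 * (Cε (m₀, n₀) 2 1 * (Cε (0, n₀) 1 3 * (Cε (0, 0) 3 0 * z ^ (-n₀)) *
        z ^ (-m₀)) * z ^ (-n₀)) = z ^ m₀ := by
    intro z hz h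
    have e : z ^ (2 * (m₀ + n₀)) = z ^ n₀ * z ^ m₀ * z ^ n₀ * z ^ m₀ := by
      rw [← zpow_add₀ hz, ← zpow_add₀ hz, ← zpow_add₀ hz]; congr 1; ring
    rw [e, cPlus] at h
    have k1 := zpow_ne_zero n₀ hz
    have k2 := zpow_ne_zero m₀ hz
    simp only [zpow_neg]
    field_simp
    linear_combination -h
  -- eigenfunctions force the quantization condition
  have A : ∀ z : ℂ, (∃ u : H, u ≠ 0 ∧ (S.comp Cop) u = z • u ∧
      SupportedOn u (imPhiPlus m₀ n₀)) → ‖z‖ = 1 ∧ z ^ (2 * (m₀ + n₀)) = cPlus m₀ n₀ Cε := by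
    rintro z ⟨u, hu, hUu, hs⟩
    have hnz : ‖z‖ = 1 := by
      have h1 : ‖(S.comp Cop) u‖ = ‖u‖ := ContinuousLinearMap.norm_map_of_mem_unitary hUnit u
      rw [hUu, norm_smul] at h1
      have h2 : ‖u‖ ≠ 0 := norm_ne_zero_iff.2 hu
      exact mul_right_cancel₀ h2 (by rw [h1, one_mul])
    have hz : z ≠ 0 := by rintro rfl; simp at hnz
    refine ⟨hnz, fwd hm hn hz hoff (fun x i => u x i) ?_ hs ?_⟩
    · intro x i
      rw [← op_apply hS hCop, hUu]
      rfl
    · by_contra hc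
      push Not at hc
      apply hu
      ext x i
      exact hc x i
  -- construction of eigenfunctions
  have B : ‖cPlus m₀ n₀ Cε‖ = 1 → ∀ z : ℂ, z ≠ 0 → z ^ (2 * (m₀ + n₀)) = cPlus m₀ n₀ Cε →
      ∃ u : H, u ≠ 0 ∧ (S.comp Cop) u = z • u ∧ SupportedOn u (imPhiPlus m₀ n₀) := by
    intro hc z hz hzc
    rw [cPlus, norm_mul, norm_mul, norm_mul] at hc
    obtain ⟨c1, c2, c3, c4⟩ := norms_one _ _ _ _ (norm_nonneg _) (norm_nonneg _) (norm_nonneg _)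
      (norm_nonneg _) (entry_norm_bound_of_unitary (hun _) _ _)
      (entry_norm_bound_of_unitary (hun _) _ _) (entry_norm_bound_of_unitary (hun _) _ _)
      (entry_norm_bound_of_unitary (hun _) _ _) hc
    set v := sol m₀ n₀ Cε z (Cε (0, 0) 3 0 * z ^ (-n₀))
      (Cε (0, n₀) 1 3 * (Cε (0, 0) 3 0 * z ^ (-n₀)) * z ^ (-m₀))
      (Cε (m₀, n₀) 2 1 * (Cε (0, n₀) 1 3 * (Cε (0, 0) 3 0 * z ^ (-n₀)) *
        z ^ (-m₀)) * z ^ (-n₀)) with hv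
    have hs : ∀ x i, (x, i) ∉ imPhiPlus m₀ n₀ → v x i = 0 :=
      sol_supp' (col_zero _ (hun _) _ _ _ c1 (by decide)) (col_zero _ (hun _) _ _ _ c1 (by decide))
        (col_zero _ (hun _) _ _ _ c4 (by decide)) (col_zero _ (hun _) _ _ _ c4 (by decide))
        (col_zero _ (hun _) _ _ _ c3 (by decide)) (col_zero _ (hun _) _ _ _ c3 (by decide))
        (col_zero _ (hun _) _ _ _ c2 (by decide)) (col_zero _ (hun _) _ _ _ c2 (by decide))
    have hp : ∀ x i, ptWalk Cε v x i = z * v x i :=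
      sol_pt hm hn hz hoff z1 z2 z3 z4 rfl rfl rfl (cexpand z hz hzc)
    obtain ⟨u, huv⟩ := exists_lift hm hn v hs
    have huv' : (fun x i => u x i) = v := by ext x i; exact huv x i
    refine ⟨u, ?_, ?_, ?_⟩
    · intro h0
      have h1 := huv (0, 0) 0
      rw [hv, sol_00 hm hn, h0] at h1
      simp at h1
    · ext x i
      rw [op_apply hS hCop, huv', hp, ← huv]
      rfl
    · intro x i h
      rw [huv, hs x i h]
  have hset : ‖cPlus m₀ n₀ Cε‖ = 1 → ∀ z : ℂ,
      (∃ κ : ℝ, z = Complex.exp (-(Complex.I * (κ : ℂ))) ∧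
          Complex.exp (-(2 * ((m₀ : ℂ) + (n₀ : ℂ)) * Complex.I * (κ : ℂ))) = cPlus m₀ n₀ Cε) ↔
      z ^ (2 * (m₀ + n₀)) = cPlus m₀ n₀ Cε := by
    intro hc z
    constructor
    · rintro ⟨κ, rfl, h⟩
      rw [← exp_eq, h]
    · intro h
      have hnz : ‖z‖ = 1 := by
        rw [← h, show 2 * (m₀ + n₀) = (((2 * (m₀ + n₀)).toNat : ℕ) : ℤ) by omega, zpow_natCast,
          norm_pow] at hc
        exact (pow_eq_one_iff_of_nonneg (norm_nonneg _) (by omega)).1 hc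
      obtain ⟨κ, hκ⟩ := exists_real z hnz
      exact ⟨κ, hκ, by rw [exp_eq, ← hκ, h]⟩
  have hpow : ∀ z : ℂ, z ^ (2 * (m₀ + n₀)) = z ^ (2 * (m₀ + n₀)).toNat := fun z => by
    rw [← zpow_natCast]; congr 1; omega
  have hz0 : ‖cPlus m₀ n₀ Cε‖ = 1 → ∀ z : ℂ, z ^ (2 * (m₀ + n₀)) = cPlus m₀ n₀ Cε → z ≠ 0 := by
    rintro hc z h rfl
    rw [← h, zero_zpow _ (by omega)] at hc
    simp at hc
  refine ⟨⟨?_, ?_⟩, ?_, ?_⟩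
  · rintro ⟨z, h⟩
    obtain ⟨h1, h2⟩ := A z h
    rw [← h2, norm_zpow, h1, one_zpow]
  · intro hc
    obtain ⟨z, hz⟩ := IsAlgClosed.exists_pow_nat_eq (cPlus m₀ n₀ Cε)
      (show 0 < (2 * (m₀ + n₀)).toNat by omega)
    rw [← hpow] at hz
    exact ⟨z, B hc z (hz0 hc z hz) hz⟩
  · intro hc
    refine ⟨fun z => ?_, ?_⟩
    · rw [hset hc]
      exact ⟨fun h => (A z h).2, fun h => B hc z (hz0 hc z h) h⟩
    · simp only [hset hc, hpow]
      exact ncard_roots _ (by intro h; simp [h] at hc) _ (by omega)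
  · intro _ κ _ hκ
    rw [exp_eq] at hκ
    have hz := Complex.exp_ne_zero (-(Complex.I * κ))
    refine ⟨sol m₀ n₀ Cε (Complex.exp (-(Complex.I * κ))) _ _ _, ?_, sol_out hm hn κ rfl,
      sol_pt hm hn hz hoff z1 z2 z3 z4 rfl rfl rfl (cexpand _ hz hκ), sol_supp⟩
    intro h
    have := congrFun (congrFun h (0, 0)) 0
    rw [sol_00 hm hn] at this
    simp at this

end QWPaper
end
end
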